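/- arXiv:2210.06672 — 7 statements merged into one kernel-verified Lean document; each statement's English description precedes it below -/
import Mathlib

section
/- For the Gaussian kernel with lengthscale γ > 0, the variance term satisfies v_γ = 1 − E_{X,X'∼P}[exp(−‖X − X'‖²/(2γ²))] ≤ 1 − exp(−Tr Σ_P / γ²), where X and X' are independent with law P. In particular E_{X,X'∼P}‖X − X'‖² = 2 Tr Σ_P. -/
open MeasureTheory ProbabilityTheory

namespace MeasureTheory

variable {Ω : Type*} [MeasurableSpace Ω] {μ : Measure Ω} [IsProbabilityMeasure μ] {f : Ω → ℝ}

theorem MemLp.integrable_sq_sub_prod (hf : MemLp f 2 μ) :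
    Integrable (fun p : Ω × Ω => (f p.1 - f p.2) ^ 2) (μ.prod μ) :=
  ((hf.comp_fst μ).sub (hf.comp_snd μ)).integrable_sq

/-- The mean squared difference of two independent copies of a square-integrable random variable
is twice its variance. -/
theorem MemLp.integral_sq_sub_prod (hf : MemLp f 2 μ) :
    ∫ p : Ω × Ω, (f p.1 - f p.2) ^ 2 ∂(μ.prod μ) = 2 * variance f μ := by
  have hint : Integrable f μ := hf.integrable one_le_two
  have hfst : Integrable (fun p : Ω × Ω => f p.1 ^ 2) (μ.prod μ) := hf.integrable_sq.comp_fst μ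
  have hsnd : Integrable (fun p : Ω × Ω => f p.2 ^ 2) (μ.prod μ) := hf.integrable_sq.comp_snd μ
  have hmul : Integrable (fun p : Ω × Ω => 2 * (f p.1 * f p.2)) (μ.prod μ) :=
    (hint.mul_prod hint).const_mul 2
  have hexpand : ∀ p : Ω × Ω, (f p.1 - f p.2) ^ 2 = f p.1 ^ 2 + f p.2 ^ 2 - 2 * (f p.1 * f p.2) :=
    fun p => by ring
  simp_rw [hexpand]
  rw [integral_sub (by exact hfst.add hsnd) hmul, integral_add hfst hsnd, integral_const_mul,
    integral_prod_mul, integral_fun_fst (fun x => f x ^ 2), integral_fun_snd (fun x => f x ^ 2),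
    variance_eq_sub hf]
  simp only [probReal_univ, one_smul, Pi.pow_apply]
  ring

/-- Jensen's inequality for the exponential function. -/
theorem exp_integral_le_integral_exp (hf : Integrable f μ)
    (hexp : Integrable (fun x => Real.exp (f x)) μ) :
    Real.exp (∫ x, f x ∂μ) ≤ ∫ x, Real.exp (f x) ∂μ :=
  convexOn_exp.map_integral_le Real.continuous_exp.continuousOn isClosed_univ
    (Filter.Eventually.of_forall fun _ => Set.mem_univ _) hf hexp

end MeasureTheory

/-- For the Gaussian kernel with lengthscale `γ > 0`, the variance term
`v_γ = 1 − E_{X,X'∼P}[exp(−‖X − X'‖²/(2γ²))]` satisfies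
`v_γ ≤ 1 − exp(−Tr Σ_P / γ²)`; in particular `E_{X,X'∼P}‖X − X'‖² = 2 Tr Σ_P`. -/
theorem gaussian_kernel_variance_bound
    {d : ℕ} (P : Measure (EuclideanSpace ℝ (Fin d))) [IsProbabilityMeasure P]
    (hP2 : Integrable (fun x => ‖x‖ ^ 2) P)
    (γ : ℝ) (hγ : 0 < γ)
    (trSigma : ℝ) (htrSigma : trSigma = ∑ i, variance (fun x => x i) P)
    (vγ : ℝ)
    (hvγ : vγ = 1 - ∫ p, Real.exp (-‖p.1 - p.2‖ ^ 2 / (2 * γ ^ 2)) ∂(P.prod P)) :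
    vγ ≤ 1 - Real.exp (-trSigma / γ ^ 2) ∧
      (∫ p, ‖p.1 - p.2‖ ^ 2 ∂(P.prod P)) = 2 * trSigma := by
  have hcoord : ∀ i, MemLp (fun x : EuclideanSpace ℝ (Fin d) => x i) 2 P := fun i => by
    have hmeas : Measurable fun x : EuclideanSpace ℝ (Fin d) => x i := by fun_prop
    refine (memLp_two_iff_integrable_sq hmeas.aestronglyMeasurable).2
      (hP2.mono' (hmeas.pow_const 2).aestronglyMeasurable (Filter.Eventually.of_forall fun x => ?_))
    rw [norm_pow]
    gcongr
    exact PiLp.norm_apply_le x i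
  have hnorm : ∀ p : EuclideanSpace ℝ (Fin d) × EuclideanSpace ℝ (Fin d),
      ‖p.1 - p.2‖ ^ 2 = ∑ i, (p.1 i - p.2 i) ^ 2 := fun p => by
    simp [EuclideanSpace.norm_sq_eq]
  have hint : Integrable (fun p : EuclideanSpace ℝ (Fin d) × EuclideanSpace ℝ (Fin d) =>
      ‖p.1 - p.2‖ ^ 2) (P.prod P) := by
    simp_rw [hnorm]
    exact integrable_finsetSum _ fun i _ => (hcoord i).integrable_sq_sub_prod
  have hmean : ∫ p, ‖p.1 - p.2‖ ^ 2 ∂(P.prod P) = 2 * trSigma := by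
    simp_rw [hnorm]
    rw [integral_finsetSum _ fun i _ => (hcoord i).integrable_sq_sub_prod, htrSigma,
      Finset.mul_sum]
    exact Finset.sum_congr rfl fun i _ => (hcoord i).integral_sq_sub_prod
  refine ⟨?_, hmean⟩
  have hexp : Integrable (fun p : EuclideanSpace ℝ (Fin d) × EuclideanSpace ℝ (Fin d) =>
      Real.exp (-‖p.1 - p.2‖ ^ 2 / (2 * γ ^ 2))) (P.prod P) := by
    refine (integrable_const (1 : ℝ)).mono' (by fun_prop) (Filter.Eventually.of_forall fun p => ?_)
    rw [Real.norm_eq_abs, Real.abs_exp, Real.exp_le_one_iff]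
    exact div_nonpos_of_nonpos_of_nonneg (neg_nonpos.2 (by positivity)) (by positivity)
  have hjensen := exp_integral_le_integral_exp (hint.neg.div_const (2 * γ ^ 2)) hexp
  simp only [Pi.neg_apply] at hjensen
  rw [integral_div, integral_neg, hmean] at hjensen
  have hscale : -(2 * trSigma) / (2 * γ ^ 2) = -trSigma / γ ^ 2 := by
    rw [← mul_neg, mul_div_mul_left _ _ two_ne_zero]
  rw [hscale] at hjensen
  rw [hvγ]
  linarith
end

section
/- For x = (x_1, …, x_n) ∈ ([0,1]^d)^n define Tr Σ̂(x) = Σ_{i=1}^d (1/(2n(n−1))) Σ_{s=1}^n Σ_{t=1}^n (x_t^i − x_s^i)². Then the function x ↦ Tr Σ̂(x)/d from ([0,1]^d)^n to ℝ₊ is weakly (n/(n−1), 0)-self-bounding and has the bounded differences property. -/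
open MeasureTheory

/-- The sum of the squared coordinate differences between the point `x t` and all the points. -/
def sumSqDiff {d n : ℕ} (x : Fin n → Fin d → ℝ) (t : Fin n) : ℝ :=
  ∑ s : Fin n, ∑ i : Fin d, (x t i - x s i) ^ 2

lemma sumSqDiff_nonneg {d n : ℕ} (x : Fin n → Fin d → ℝ) (t : Fin n) : 0 ≤ sumSqDiff x t :=
  Finset.sum_nonneg fun _ _ => Finset.sum_nonneg fun _ _ => sq_nonneg _

lemma sumSqDiff_le {d n : ℕ} {x : Fin n → Fin d → ℝ}
    (hx : ∀ t i, x t i ∈ Set.Icc (0 : ℝ) 1) (t : Fin n) :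
    sumSqDiff x t ≤ ((n : ℝ) - 1) * d := by
  have hterm : ∀ s : Fin n,
      ∑ i : Fin d, (x t i - x s i) ^ 2 ≤ (d : ℝ) - if s = t then (d : ℝ) else 0 := by
    intro s
    split_ifs with h
    · simp [h]
    · calc ∑ i : Fin d, (x t i - x s i) ^ 2 ≤ ∑ _i : Fin d, (1 : ℝ) := by
            refine Finset.sum_le_sum fun i _ => ?_
            have h₁ := hx t i
            have h₂ := hx s i
            rw [sq_le_one_iff_abs_le_one, abs_le]
            constructor <;> linarith [h₁.1, h₁.2, h₂.1, h₂.2]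
        _ = (d : ℝ) - 0 := by simp
  calc sumSqDiff x t ≤ ∑ s : Fin n, ((d : ℝ) - if s = t then (d : ℝ) else 0) :=
        Finset.sum_le_sum fun s _ => hterm s
    _ = ((n : ℝ) - 1) * d := by
        simp [Finset.sum_sub_distrib]
        ring

/-- Replacing one point lowers the total sum of squared differences by at most twice the
contribution of that point. -/
lemma sum_sumSqDiff_le_update {d n : ℕ} (x : Fin n → Fin d → ℝ) (t₀ : Fin n) (y : Fin d → ℝ) :
    ∑ t, sumSqDiff x t ≤ ∑ t, sumSqDiff (Function.update x t₀ y) t + 2 * sumSqDiff x t₀ := by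
  have hterm : ∀ t s : Fin n, ∑ i : Fin d, (x t i - x s i) ^ 2 ≤
      ∑ i : Fin d, (Function.update x t₀ y t i - Function.update x t₀ y s i) ^ 2
        + (if t = t₀ then ∑ i : Fin d, (x t₀ i - x s i) ^ 2 else 0)
        + (if s = t₀ then ∑ i : Fin d, (x t₀ i - x t i) ^ 2 else 0) := by
    intro t s
    have hnn : ∀ u v : Fin d → ℝ, 0 ≤ ∑ i : Fin d, (u i - v i) ^ 2 := fun u v =>
      Finset.sum_nonneg fun _ _ => sq_nonneg _
    have hu := hnn (Function.update x t₀ y t) (Function.update x t₀ y s)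
    by_cases ht : t = t₀
    · subst ht
      rw [if_pos rfl]
      split_ifs
      · linarith [hnn (x t) (x t)]
      · linarith
    · by_cases hs : s = t₀
      · subst hs
        have hsymm : ∑ i : Fin d, (x t i - x s i) ^ 2 = ∑ i : Fin d, (x s i - x t i) ^ 2 :=
          Finset.sum_congr rfl fun i _ => by ring
        rw [if_neg ht, if_pos rfl]
        linarith
      · simp [ht, hs]
  refine (Finset.sum_le_sum fun t _ => Finset.sum_le_sum fun s _ => hterm t s).trans
    (le_of_eq ?_)
  have hfirst : ∑ t : Fin n, ∑ s : Fin n,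
      (if t = t₀ then ∑ i : Fin d, (x t₀ i - x s i) ^ 2 else 0) = sumSqDiff x t₀ := by
    rw [Finset.sum_comm]
    simp [sumSqDiff]
  have hsecond : ∑ t : Fin n, ∑ s : Fin n,
      (if s = t₀ then ∑ i : Fin d, (x t₀ i - x t i) ^ 2 else 0) = sumSqDiff x t₀ := by
    simp [sumSqDiff]
  simp only [Finset.sum_add_distrib]
  rw [hfirst, hsecond]
  simp only [sumSqDiff]
  ring

/-- On the hypercube `[0,1]^d`, the normalized empirical total variance
`x ↦ Tr Σ̂(x)/d` is weakly `(n/(n−1), 0)`-self-bounding and has the bounded differences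
property. -/
theorem trace_empirical_covariance_self_bounding
    (d n : ℕ) (hd : 0 < d) (hn : 2 ≤ n)
    (f : (Fin n → Fin d → ℝ) → ℝ)
    (hf : ∀ x, f x = (1 / (d : ℝ)) * ∑ i : Fin d,
      (1 / (2 * (n : ℝ) * ((n : ℝ) - 1))) * ∑ s : Fin n, ∑ t : Fin n, (x t i - x s i) ^ 2) :
    (∀ x : Fin n → Fin d → ℝ, (∀ t i, x t i ∈ Set.Icc (0 : ℝ) 1) →
      ∑ t₀ : Fin n,
          (f x - ⨅ x' : {y : Fin d → ℝ // ∀ i, y i ∈ Set.Icc (0 : ℝ) 1},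
            f (Function.update x t₀ x'.1)) ^ 2
        ≤ ((n : ℝ) / ((n : ℝ) - 1)) * f x + 0) ∧
    (∀ x : Fin n → Fin d → ℝ, (∀ t i, x t i ∈ Set.Icc (0 : ℝ) 1) → ∀ t₀ : Fin n,
      f x - (⨅ x' : {y : Fin d → ℝ // ∀ i, y i ∈ Set.Icc (0 : ℝ) 1},
        f (Function.update x t₀ x'.1)) ≤ 1) := by
  have hn' : (2 : ℝ) ≤ n := by exact_mod_cast hn
  have hd' : (0 : ℝ) < d := by exact_mod_cast hd
  have hn₁ : (0 : ℝ) < (n : ℝ) - 1 := by linarith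
  have hn₀ : (0 : ℝ) < n := by linarith
  obtain ⟨c, hc⟩ : ∃ c : ℝ, c = 1 / (2 * d * n * ((n : ℝ) - 1)) := ⟨_, rfl⟩
  have hc₀ : 0 < c := by rw [hc]; positivity
  have hfc : ∀ x, f x = c * ∑ t, sumSqDiff x t := by
    intro x
    have hswap : ∑ t, sumSqDiff x t
        = ∑ i : Fin d, ∑ s : Fin n, ∑ t : Fin n, (x t i - x s i) ^ 2 := by
      simp only [sumSqDiff]
      rw [Finset.sum_comm, Finset.sum_comm (s := (Finset.univ : Finset (Fin d)))]
      exact Finset.sum_congr rfl fun s _ => Finset.sum_comm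
    rw [hf, hswap, ← Finset.mul_sum, ← mul_assoc, hc]
    congr 1
    field_simp
  have hf₀ : ∀ x, 0 ≤ f x := fun x => by
    rw [hfc]
    exact mul_nonneg hc₀.le (Finset.sum_nonneg fun t _ => sumSqDiff_nonneg x t)
  have hdrop : ∀ x : Fin n → Fin d → ℝ, (∀ t i, x t i ∈ Set.Icc (0 : ℝ) 1) → ∀ t₀ : Fin n,
      0 ≤ f x - (⨅ x' : {y : Fin d → ℝ // ∀ i, y i ∈ Set.Icc (0 : ℝ) 1},
        f (Function.update x t₀ x'.1)) ∧
      f x - (⨅ x' : {y : Fin d → ℝ // ∀ i, y i ∈ Set.Icc (0 : ℝ) 1},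
        f (Function.update x t₀ x'.1)) ≤ 2 * c * sumSqDiff x t₀ := by
    intro x hx t₀
    have : Nonempty {y : Fin d → ℝ // ∀ i, y i ∈ Set.Icc (0 : ℝ) 1} := ⟨⟨x t₀, hx t₀⟩⟩
    constructor
    · have hbdd : BddBelow (Set.range fun x' : {y : Fin d → ℝ // ∀ i, y i ∈ Set.Icc (0 : ℝ) 1} =>
          f (Function.update x t₀ x'.1)) := ⟨0, by rintro _ ⟨y, rfl⟩; exact hf₀ _⟩
      have hle := ciInf_le hbdd ⟨x t₀, hx t₀⟩
      simp only [Function.update_eq_self] at hle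
      linarith
    · have hle : f x - 2 * c * sumSqDiff x t₀ ≤
          ⨅ x' : {y : Fin d → ℝ // ∀ i, y i ∈ Set.Icc (0 : ℝ) 1},
            f (Function.update x t₀ x'.1) := by
        refine le_ciInf fun y => ?_
        rw [hfc, hfc]
        linarith [mul_le_mul_of_nonneg_left (sum_sumSqDiff_le_update x t₀ y.1) hc₀.le]
      linarith
  have hsmall : ∀ x : Fin n → Fin d → ℝ, (∀ t i, x t i ∈ Set.Icc (0 : ℝ) 1) → ∀ t₀ : Fin n,
      2 * c * sumSqDiff x t₀ ≤ 1 / n := by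
    intro x hx t₀
    calc 2 * c * sumSqDiff x t₀ ≤ 2 * c * (((n : ℝ) - 1) * d) :=
          mul_le_mul_of_nonneg_left (sumSqDiff_le hx t₀) (by positivity)
      _ = 1 / n := by rw [hc]; field_simp
  constructor
  · intro x hx
    have hsq : ∀ t₀ : Fin n,
        (f x - ⨅ x' : {y : Fin d → ℝ // ∀ i, y i ∈ Set.Icc (0 : ℝ) 1},
          f (Function.update x t₀ x'.1)) ^ 2 ≤ 1 / n * (2 * c * sumSqDiff x t₀) := by
      intro t₀
      obtain ⟨h₀, h₁⟩ := hdrop x hx t₀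
      rw [sq]
      exact mul_le_mul (h₁.trans (hsmall x hx t₀)) h₁ h₀ (by positivity)
    calc _ ≤ ∑ t₀ : Fin n, 1 / n * (2 * c * sumSqDiff x t₀) :=
          Finset.sum_le_sum fun t₀ _ => hsq t₀
      _ = 2 / n * f x := by
          rw [hfc, ← Finset.mul_sum, ← Finset.mul_sum]
          ring
      _ ≤ (n : ℝ) / ((n : ℝ) - 1) * f x := by
          refine mul_le_mul_of_nonneg_right ?_ (hf₀ x)
          rw [div_le_div_iff₀ hn₀ hn₁]
          nlinarith
      _ = (n : ℝ) / ((n : ℝ) - 1) * f x + 0 := (add_zero _).symm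
  · intro x hx t₀
    have hone : (1 : ℝ) / n ≤ 1 := by
      rw [div_le_one hn₀]
      linarith
    exact (hdrop x hx t₀).2.trans ((hsmall x hx t₀).trans hone)
end

section
/- Let X_1, …, X_n be i.i.d. from a probability measure P on [0,1]^d, n ≥ 2. With Tr Σ_P = Σ_{i=1}^d Var(X^i) and Tr Σ̂(X) = Σ_{i=1}^d (1/(2n(n−1))) Σ_{s=1}^n Σ_{t=1}^n (X_t^i − X_s^i)², for each b ∈ {−1, 1} and δ ∈ (0,1): P( b·[√(Tr Σ_P/d) − √(Tr Σ̂(X)/d)] > √(2 log(1/δ)/(n−1)) ) ≤ δ. -/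
open MeasureTheory ProbabilityTheory

theorem measurePreserving_pi_pairs {n m : ℕ} {E : Type*} [MeasurableSpace E] (P : Measure E)
    [IsProbabilityMeasure P] {a b : Fin m → Fin n} (hab : Function.Injective (Sum.elim a b)) :
    MeasurePreserving (fun (ω : Fin n → E) j => (ω (a j), ω (b j)))
      (Measure.pi fun _ => P) (Measure.pi fun _ : Fin m => P.prod P) := by
  have hind : iIndepFun (fun i (ω : Fin n → E) => ω i) (Measure.pi fun _ => P) :=
    iIndepFun_pi (X := fun _ => id) (fun _ => aemeasurable_id)
  have hmap := (iIndepFun_iff_map_fun_eq_pi_map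
    (fun k => (measurable_pi_apply (Sum.elim a b k)).aemeasurable)).1 (hind.precomp hab)
  have hpre : MeasurePreserving (fun (ω : Fin n → E) k => ω (Sum.elim a b k))
      (Measure.pi fun _ => P) (Measure.pi fun _ : Fin m ⊕ Fin m => P) := by
    refine ⟨by fun_prop, hmap.trans ?_⟩
    congr 1
    ext1 k
    exact (measurePreserving_eval (fun _ => P) _).map_eq
  have hsum := measurePreserving_sumPiEquivProdPi (fun _ : Fin m ⊕ Fin m => P)
  have harr := (measurePreserving_arrowProdEquivProdArrow E E (Fin m) (fun _ => P)
    (fun _ => P)).symm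
  exact harr.comp (hsum.comp hpre)

theorem card_offDiag_mul_sum_perm {ι : Type*} [Fintype ι] [DecidableEq ι] (f : ι → ι → ℝ)
    {a b : ι} (hab : a ≠ b) :
    ((Finset.univ : Finset ι).offDiag.card : ℝ) * ∑ σ : Equiv.Perm ι, f (σ a) (σ b) =
      (Fintype.card (Equiv.Perm ι) : ℝ) * ∑ p ∈ (Finset.univ : Finset ι).offDiag, f p.1 p.2 := by
  have hperm (σ : Equiv.Perm ι) : ∑ p ∈ (Finset.univ : Finset ι).offDiag, f (σ p.1) (σ p.2) =
      ∑ p ∈ (Finset.univ : Finset ι).offDiag, f p.1 p.2 :=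
    Finset.sum_equiv (σ.prodCongr σ) (by simp) (by simp)
  have hpair : ∀ p ∈ (Finset.univ : Finset ι).offDiag,
      ∑ σ : Equiv.Perm ι, f (σ p.1) (σ p.2) = ∑ σ : Equiv.Perm ι, f (σ a) (σ b) := by
    intro p hp
    obtain ⟨τ, h1, h2⟩ := MulAction.is_two_pretransitive_iff.1
      (Equiv.Perm.isMultiplyPretransitive ι 2) hab (Finset.mem_offDiag.1 hp).2.2
    rw [← h1, ← h2]
    exact Equiv.sum_comp (Equiv.mulRight τ) fun σ => f (σ a) (σ b)
  calc _ = ∑ p ∈ (Finset.univ : Finset ι).offDiag, ∑ σ : Equiv.Perm ι, f (σ p.1) (σ p.2) := by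
        rw [Finset.sum_congr rfl hpair, Finset.sum_const, nsmul_eq_mul]
    _ = _ := by
        rw [Finset.sum_comm, Finset.sum_congr rfl fun σ _ => hperm σ, Finset.sum_const,
          nsmul_eq_mul, Finset.card_univ]

theorem mgf_le_exp_of_mem_Icc {Ω : Type*} [MeasurableSpace Ω] {μ : Measure Ω}
    [IsProbabilityMeasure μ] {g : Ω → ℝ} (hg : Measurable g)
    (hmem : ∀ᵐ z ∂μ, g z ∈ Set.Icc (0 : ℝ) 1) (t : ℝ) :
    mgf g μ t ≤ Real.exp (μ[g] * (Real.exp t - 1)) := by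
  have hint : Integrable g μ := Integrable.of_mem_Icc 0 1 hg.aemeasurable hmem
  calc mgf g μ t ≤ ∫ z, (1 + g z * (Real.exp t - 1)) ∂μ := by
        refine integral_mono_ae (integrable_exp_mul_of_mem_Icc hg.aemeasurable hmem)
          (by fun_prop) ?_
        filter_upwards [hmem] with z hz
        have := convexOn_exp.2 (Set.mem_univ 0) (Set.mem_univ t) (sub_nonneg.2 hz.2) hz.1
          (by ring)
        simp only [smul_eq_mul, mul_zero, zero_add, Real.exp_zero] at this
        rw [mul_comm t]
        linarith
    _ = μ[g] * (Real.exp t - 1) + 1 := by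
        rw [integral_add (by fun_prop) (by fun_prop), integral_mul_const]
        simp [add_comm]
    _ ≤ _ := Real.add_one_le_exp _

theorem mgf_mean_pairs_le {n m : ℕ} (hm : 0 < m) {E : Type*} [MeasurableSpace E] (P : Measure E)
    [IsProbabilityMeasure P] {g : E × E → ℝ} (hg : Measurable g)
    (hmem : ∀ᵐ z ∂P.prod P, g z ∈ Set.Icc (0 : ℝ) 1)
    {a b : Fin m → Fin n} (hab : Function.Injective (Sum.elim a b)) (t : ℝ) :
    mgf (fun ω => (m : ℝ)⁻¹ * ∑ j, g (ω (a j), ω (b j))) (Measure.pi fun _ => P) (m * t) ≤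
      Real.exp (m * ((P.prod P)[g] * (Real.exp t - 1))) := by
  have hm' : (m : ℝ) ≠ 0 := by positivity
  have hT := measurePreserving_pi_pairs P hab
  have hexp (ω : Fin n → E) : Real.exp (m * t * ((m : ℝ)⁻¹ * ∑ j, g (ω (a j), ω (b j)))) =
      ∏ j, Real.exp (t * g (ω (a j), ω (b j))) := by
    rw [← Real.exp_sum, ← Finset.mul_sum]
    congr 1
    field_simp
  have hmeas : Measurable fun z : Fin m → E × E => ∏ j, Real.exp (t * g (z j)) := by fun_prop
  calc mgf (fun ω => (m : ℝ)⁻¹ * ∑ j, g (ω (a j), ω (b j))) (Measure.pi fun _ => P) (m * t)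
      = ∫ z, ∏ j, Real.exp (t * g (z j)) ∂(Measure.pi fun _ : Fin m => P.prod P) := by
        rw [← hT.map_eq, integral_map hT.measurable.aemeasurable hmeas.aestronglyMeasurable]
        exact integral_congr_ae (ae_of_all _ hexp)
    _ = mgf g (P.prod P) t ^ m := by
        rw [integral_fintype_prod_eq_pow (fun z => Real.exp (t * g z)), Fintype.card_fin, mgf]
    _ ≤ _ := by
        rw [Real.exp_nat_mul]
        exact pow_le_pow_left₀ mgf_nonneg (mgf_le_exp_of_mem_Icc hg hmem t) m

/-- The U-statistic with kernel `g`, averaging `g` over all ordered pairs of distinct indices. -/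
noncomputable def uStatistic {n : ℕ} {E : Type*} (g : E × E → ℝ) (ω : Fin n → E) : ℝ :=
  ((Finset.univ : Finset (Fin n)).offDiag.card : ℝ)⁻¹ *
    ∑ p ∈ (Finset.univ : Finset (Fin n)).offDiag, g (ω p.1, ω p.2)

theorem measurable_uStatistic {n : ℕ} {E : Type*} [MeasurableSpace E] {g : E × E → ℝ}
    (hg : Measurable g) : Measurable (uStatistic g : (Fin n → E) → ℝ) := by
  unfold uStatistic
  fun_prop

theorem uStatistic_mem_Icc {n : ℕ} {E : Type*} [MeasurableSpace E] (P : Measure E)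
    [IsProbabilityMeasure P] {g : E × E → ℝ}
    (hmem : ∀ᵐ z ∂P.prod P, g z ∈ Set.Icc (0 : ℝ) 1) :
    ∀ᵐ ω ∂(Measure.pi fun _ : Fin n => P), uStatistic g ω ∈ Set.Icc (0 : ℝ) 1 := by
  have h : ∀ᵐ ω ∂(Measure.pi fun _ : Fin n => P),
      ∀ p ∈ (Finset.univ : Finset (Fin n)).offDiag, g (ω p.1, ω p.2) ∈ Set.Icc (0 : ℝ) 1 := by
    rw [Finset.eventually_all]
    intro p hp
    have hinj : Function.Injective (Sum.elim (fun _ : Fin 1 => p.1) (fun _ : Fin 1 => p.2)) := by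
      have := (Finset.mem_offDiag.1 hp).2.2
      rintro (i | i) (j | j) h <;> simp_all [Subsingleton.elim i j]
    exact ((measurePreserving_eval (fun _ : Fin 1 => P.prod P) 0).comp
      (measurePreserving_pi_pairs P hinj)).quasiMeasurePreserving.ae hmem
  filter_upwards [h] with ω hω
  refine ⟨mul_nonneg (by positivity) (Finset.sum_nonneg fun p hp => (hω p hp).1), ?_⟩
  refine inv_mul_le_one_of_le₀ ?_ (by positivity)
  simpa using Finset.sum_le_card_nsmul _ _ 1 fun p hp => (hω p hp).2

theorem uStatistic_eq_mean_perm {n m : ℕ} (hm : 0 < m) {E : Type*} (g : E × E → ℝ)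
    {a b : Fin m → Fin n} (hab : ∀ j, a j ≠ b j) (ω : Fin n → E) :
    uStatistic g ω = ∑ σ : Equiv.Perm (Fin n), (Fintype.card (Equiv.Perm (Fin n)) : ℝ)⁻¹ *
      ((m : ℝ)⁻¹ * ∑ j, g (ω (σ (a j)), ω (σ (b j)))) := by
  have hm' : (m : ℝ) ≠ 0 := by positivity
  have hoff : ((Finset.univ : Finset (Fin n)).offDiag.card : ℝ) ≠ 0 := by
    have : (a ⟨0, hm⟩, b ⟨0, hm⟩) ∈ (Finset.univ : Finset (Fin n)).offDiag := by
      simpa using hab _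
    exact_mod_cast (Finset.card_pos.2 ⟨_, this⟩).ne'
  have hfac : (Fintype.card (Equiv.Perm (Fin n)) : ℝ) ≠ 0 := by
    exact_mod_cast Fintype.card_ne_zero
  have hj (j : Fin m) : ∑ σ : Equiv.Perm (Fin n), g (ω (σ (a j)), ω (σ (b j))) =
      (Fintype.card (Equiv.Perm (Fin n)) : ℝ) * uStatistic g ω := by
    have := card_offDiag_mul_sum_perm (fun s t => g (ω s, ω t)) (hab j)
    unfold uStatistic
    field_simp
    linarith
  rw [← Finset.mul_sum, ← Finset.mul_sum, Finset.sum_comm, Finset.sum_congr rfl fun j _ => hj j]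
  simp only [Finset.sum_const, Finset.card_univ, Fintype.card_fin, nsmul_eq_mul]
  field_simp

/-- Hoeffding's decomposition of a U-statistic into averages of `n / 2` independent terms gives
a Poisson-type bound on its moment generating function. -/
theorem mgf_uStatistic_le {n : ℕ} (hn : 2 ≤ n) {E : Type*} [MeasurableSpace E] (P : Measure E)
    [IsProbabilityMeasure P] {g : E × E → ℝ} (hg : Measurable g)
    (hmem : ∀ᵐ z ∂P.prod P, g z ∈ Set.Icc (0 : ℝ) 1) (t : ℝ) :
    mgf (uStatistic g) (Measure.pi fun _ : Fin n => P) ((n / 2 : ℕ) * t) ≤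
      Real.exp ((n / 2 : ℕ) * ((P.prod P)[g] * (Real.exp t - 1))) := by
  set m := n / 2 with hmdef
  have hm : 0 < m := by omega
  let a : Fin m → Fin n := fun j => ⟨2 * j, by omega⟩
  let b : Fin m → Fin n := fun j => ⟨2 * j + 1, by omega⟩
  have hab : Function.Injective (Sum.elim a b) := by
    rintro (i | i) (j | j) h <;> simp [a, b, Fin.ext_iff] at h ⊢ <;> omega
  have hne (j : Fin m) : a j ≠ b j := by simp [a, b]
  let W (σ : Equiv.Perm (Fin n)) (ω : Fin n → E) : ℝ :=
    (m : ℝ)⁻¹ * ∑ j, g (ω (σ (a j)), ω (σ (b j)))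
  have hσ (σ : Equiv.Perm (Fin n)) : Function.Injective (Sum.elim (σ ∘ a) (σ ∘ b)) := by
    rw [← Sum.comp_elim]
    exact σ.injective.comp hab
  have hWmem (σ : Equiv.Perm (Fin n)) :
      ∀ᵐ ω ∂(Measure.pi fun _ : Fin n => P), W σ ω ∈ Set.Icc (0 : ℝ) 1 := by
    have hmem' : ∀ᵐ z ∂(Measure.pi fun _ : Fin m => P.prod P),
        ∀ j, g (z j) ∈ Set.Icc (0 : ℝ) 1 := by
      rw [ae_all_iff]
      exact fun j => (measurePreserving_eval (fun _ : Fin m => P.prod P)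
        j).quasiMeasurePreserving.ae hmem
    filter_upwards [(measurePreserving_pi_pairs P (hσ σ)).quasiMeasurePreserving.ae hmem']
      with ω hω
    refine ⟨mul_nonneg (by positivity) (Finset.sum_nonneg fun j _ => (hω j).1), ?_⟩
    refine inv_mul_le_one_of_le₀ ?_ (by positivity)
    simpa using Finset.sum_le_card_nsmul Finset.univ _ 1 fun j _ => (hω j).2
  have hWmeas (σ : Equiv.Perm (Fin n)) : Measurable (W σ) := by
    simp only [W]
    fun_prop
  have hWint (σ : Equiv.Perm (Fin n)) (s : ℝ) :
      Integrable (fun ω => Real.exp (s * W σ ω)) (Measure.pi fun _ : Fin n => P) :=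
    integrable_exp_mul_of_mem_Icc (hWmeas σ).aemeasurable (hWmem σ)
  set c : ℝ := (Fintype.card (Equiv.Perm (Fin n)) : ℝ)⁻¹ with hc
  have hcsum : ∑ _σ : Equiv.Perm (Fin n), c = 1 := by
    rw [Finset.sum_const, Finset.card_univ, nsmul_eq_mul, hc]
    exact mul_inv_cancel₀ (by exact_mod_cast Fintype.card_ne_zero)
  have hc0 : 0 ≤ c := by positivity
  calc mgf (uStatistic g) (Measure.pi fun _ : Fin n => P) (m * t)
      ≤ ∫ ω, ∑ σ, c * Real.exp (m * t * W σ ω) ∂(Measure.pi fun _ : Fin n => P) := by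
        refine integral_mono (integrable_exp_mul_of_mem_Icc
          (measurable_uStatistic hg).aemeasurable (uStatistic_mem_Icc P hmem))
          (integrable_finsetSum _ fun σ _ => (hWint σ _).const_mul c) fun ω => ?_
        have := convexOn_exp.map_sum_le (t := Finset.univ) (w := fun _ => c)
          (p := fun σ => m * t * W σ ω) (fun _ _ => hc0) hcsum (by simp)
        simp only [smul_eq_mul] at this
        rw [uStatistic_eq_mean_perm hm g hne, Finset.mul_sum]
        convert this using 3 with σ
        simp only [W]
        ring
    _ = ∑ σ, c * mgf (W σ) (Measure.pi fun _ : Fin n => P) (m * t) := by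
        rw [integral_finsetSum _ fun σ _ => (hWint σ _).const_mul c]
        simp_rw [integral_const_mul, mgf]
    _ ≤ ∑ _σ : Equiv.Perm (Fin n), c *
          Real.exp (m * ((P.prod P)[g] * (Real.exp t - 1))) := by
        gcongr with σ
        exact mgf_mean_pairs_le hm P hg hmem (hσ σ) t
    _ = _ := by rw [← Finset.sum_mul, hcsum, one_mul]

theorem exists_poisson_tilt {p s : ℝ} (hp : 0 ≤ p) (hs : 0 < s) :
    ∃ t : ℝ, 0 ≤ t * (s - p) ∧ (s - p) ^ 2 ≤ t * s ^ 2 - p ^ 2 * (Real.exp t - 1) := by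
  rcases hp.eq_or_lt with rfl | hp
  · exact ⟨1, by linarith, by nlinarith⟩
  · have hlog : (s - p) / s ≤ Real.log (s / p) := by
      have := Real.one_sub_inv_le_log_of_pos (div_pos hs hp)
      rwa [inv_div, one_sub_div hs.ne'] at this
    refine ⟨Real.log (s / p), ?_, ?_⟩
    · rcases le_total p s with h | h
      · exact mul_nonneg (Real.log_nonneg ((one_le_div hp).2 h)) (sub_nonneg.2 h)
      · exact mul_nonneg_of_nonpos_of_nonpos
          (Real.log_nonpos (by positivity) ((div_le_one hp).2 h)) (sub_nonpos.2 h)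
    · rw [Real.exp_log (div_pos hs hp)]
      have h1 : (s - p) * s ≤ Real.log (s / p) * s ^ 2 := by
        calc (s - p) * s = (s - p) / s * s ^ 2 := by field_simp
          _ ≤ _ := by gcongr
      have h2 : p ^ 2 * (s / p - 1) = p * s - p ^ 2 := by field_simp
      linarith

theorem measureReal_sqrt_uStatistic_le {n : ℕ} (hn : 2 ≤ n) {E : Type*} [MeasurableSpace E]
    (P : Measure E) [IsProbabilityMeasure P] {g : E × E → ℝ} (hg : Measurable g)
    (hmem : ∀ᵐ z ∂P.prod P, g z ∈ Set.Icc (0 : ℝ) 1) {b : ℝ} (hb : b = -1 ∨ b = 1)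
    {q : ℝ} (hq : 0 < q) :
    (Measure.pi fun _ : Fin n => P).real
      {ω | q < b * (Real.sqrt (P.prod P)[g] - Real.sqrt (uStatistic g ω))} ≤
      Real.exp (-((n / 2 : ℕ) * q ^ 2)) := by
  set ν := Measure.pi fun _ : Fin n => P
  set p := Real.sqrt (P.prod P)[g]
  set m : ℝ := ((n / 2 : ℕ) : ℝ)
  have hp : 0 ≤ p := Real.sqrt_nonneg _
  have hm : 0 ≤ m := Nat.cast_nonneg _
  have hpsq : p ^ 2 = (P.prod P)[g] :=
    Real.sq_sqrt (integral_nonneg_of_ae (hmem.mono fun z hz => hz.1))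
  have hint (s : ℝ) : Integrable (fun ω => Real.exp (s * uStatistic g ω)) ν :=
    integrable_exp_mul_of_mem_Icc (measurable_uStatistic hg).aemeasurable
      (uStatistic_mem_Icc P hmem)
  have hbound {s t : ℝ} (hsq : (s - p) ^ 2 = q ^ 2)
      (ht : (s - p) ^ 2 ≤ t * s ^ 2 - p ^ 2 * (Real.exp t - 1)) :
      Real.exp (-(m * t) * s ^ 2) * mgf (uStatistic g) ν (m * t) ≤ Real.exp (-(m * q ^ 2)) := by
    calc _ ≤ Real.exp (-(m * t) * s ^ 2) * Real.exp (m * (p ^ 2 * (Real.exp t - 1))) := by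
          rw [hpsq]
          gcongr
          exact mgf_uStatistic_le hn P hg hmem t
      _ ≤ _ := by
          rw [← Real.exp_add, Real.exp_le_exp, ← hsq]
          nlinarith [mul_le_mul_of_nonneg_left ht hm]
  rcases hb with rfl | rfl
  · obtain ⟨t, ht0, ht⟩ := exists_poisson_tilt hp (s := p + q) (by positivity)
    rw [add_sub_cancel_left] at ht0
    have hsub : {ω : Fin n → E | q < -1 * (p - Real.sqrt (uStatistic g ω))} ⊆
        {ω | (p + q) ^ 2 ≤ uStatistic g ω} := by
      intro ω hω
      simp only [Set.mem_ofPred_eq] at hω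
      exact (Real.le_sqrt' (by positivity)).1 (by linarith)
    exact (measureReal_mono hsub).trans <| (measure_ge_le_exp_mul_mgf _
      (mul_nonneg hm (nonneg_of_mul_nonneg_left ht0 hq)) (hint _)).trans (hbound (by ring) ht)
  · rcases le_or_gt (p - q) 0 with hs | hs
    · have hempty : {ω : Fin n → E | q < 1 * (p - Real.sqrt (uStatistic g ω))} = ∅ := by
        ext ω
        simp only [Set.mem_ofPred_eq, Set.mem_empty_iff_false, iff_false, not_lt]
        linarith [Real.sqrt_nonneg (uStatistic g ω)]
      rw [hempty, measureReal_empty]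
      positivity
    · obtain ⟨t, ht0, ht⟩ := exists_poisson_tilt hp hs
      have ht0' : t ≤ 0 := by nlinarith
      have hsub : {ω : Fin n → E | q < 1 * (p - Real.sqrt (uStatistic g ω))} ⊆
          {ω | uStatistic g ω ≤ (p - q) ^ 2} := by
        intro ω hω
        simp only [Set.mem_ofPred_eq] at hω
        exact ((Real.sqrt_lt' hs).1 (by linarith)).le
      exact (measureReal_mono hsub).trans <| (measure_le_le_exp_mul_mgf _
        (mul_nonpos_of_nonneg_of_nonpos hm ht0') (hint _)).trans (hbound (by ring) ht)

theorem integral_prod_sub_sq {E : Type*} [MeasurableSpace E] (P : Measure E)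
    [IsProbabilityMeasure P] {f : E → ℝ} (hf : MemLp f 2 P) :
    ∫ z, (f z.1 - f z.2) ^ 2 ∂(P.prod P) = 2 * variance f P := by
  have hsq := hf.integrable_sq
  have hint := hf.integrable (by norm_num)
  have h1 : Integrable (fun z : E × E => f z.1 ^ 2) (P.prod P) := hsq.comp_fst P
  have h2 : Integrable (fun z : E × E => f z.2 ^ 2) (P.prod P) := hsq.comp_snd P
  have h12 : Integrable (fun z : E × E => f z.1 * f z.2) (P.prod P) := hint.mul_prod hint
  have heq : (fun z : E × E => (f z.1 - f z.2) ^ 2) =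
      fun z => f z.1 ^ 2 + f z.2 ^ 2 - 2 * (f z.1 * f z.2) := by
    ext z
    ring
  rw [heq, integral_sub (by fun_prop) (by fun_prop), integral_add h1 h2, integral_const_mul,
    integral_prod_mul, integral_fun_fst (fun x => f x ^ 2), integral_fun_snd (fun x => f x ^ 2),
    variance_eq_sub hf]
  simp
  ring

theorem uStatistic_mean_sq_eq {d n : ℕ} (ω : Fin n → Fin d → ℝ) :
    uStatistic (fun z : (Fin d → ℝ) × (Fin d → ℝ) => (∑ i, (z.1 i - z.2 i) ^ 2) / d) ω =
      2 * ((∑ i : Fin d, (1 / (2 * (n : ℝ) * ((n : ℝ) - 1))) *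
        ∑ s : Fin n, ∑ t : Fin n, (ω t i - ω s i) ^ 2) / d) := by
  have hoff : ∑ p ∈ (Finset.univ : Finset (Fin n)).offDiag,
      (∑ i, (ω p.1 i - ω p.2 i) ^ 2) / (d : ℝ) =
      (∑ i, ∑ s : Fin n, ∑ t : Fin n, (ω t i - ω s i) ^ 2) / d := by
    rw [← Finset.sum_div]
    congr 1
    rw [Finset.sum_subset (Finset.subset_univ _), Finset.sum_comm]
    · refine Finset.sum_congr rfl fun i _ => ?_
      rw [Fintype.sum_prod_type_right]
    · intro p _ hp
      simp only [Finset.mem_offDiag, Finset.mem_univ, true_and, ne_eq, not_not] at hp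
      simp [hp]
  have hcard : ((Finset.univ : Finset (Fin n)).offDiag.card : ℝ) = n * (n - 1) := by
    rw [Finset.offDiag_card, Finset.card_univ, Fintype.card_fin,
      Nat.cast_sub (Nat.le_mul_self n)]
    push_cast
    ring
  rw [uStatistic, hoff, hcard, ← Finset.mul_sum, mul_assoc (2 : ℝ), one_div, mul_inv (2 : ℝ)]
  ring

/-- For i.i.d. samples from a probability measure on the hypercube
`[0,1]^d`, the square root of the normalized empirical total variance concentrates around
the square root of `Tr Σ_P / d`: for `b ∈ {−1,1}`,
`P(b·[√(Tr Σ_P/d) − √(Tr Σ̂(X)/d)] > √(2 log(1/δ)/(n−1))) ≤ δ`. -/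
theorem sqrt_trace_variance_concentration
    (d n : ℕ) (hd : 0 < d) (hn : 2 ≤ n)
    (P : Measure (Fin d → ℝ)) [IsProbabilityMeasure P]
    (hP_supp : ∀ᵐ x ∂P, ∀ i, x i ∈ Set.Icc (0 : ℝ) 1)
    (trSigma : ℝ) (htrSigma : trSigma = ∑ i, variance (fun x => x i) P)
    (trHat : (Fin n → Fin d → ℝ) → ℝ)
    (htrHat : ∀ ω, trHat ω = ∑ i : Fin d,
      (1 / (2 * (n : ℝ) * ((n : ℝ) - 1))) * ∑ s : Fin n, ∑ t : Fin n, (ω t i - ω s i) ^ 2)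
    (b : ℝ) (hb : b = -1 ∨ b = 1)
    (δ : ℝ) (hδ : δ ∈ Set.Ioo (0 : ℝ) 1) :
    (Measure.pi fun _ : Fin n => P)
      {ω | Real.sqrt (2 * Real.log (1 / δ) / ((n : ℝ) - 1)) <
        b * (Real.sqrt (trSigma / d) - Real.sqrt (trHat ω / d))} ≤
      ENNReal.ofReal δ := by
  let g : (Fin d → ℝ) × (Fin d → ℝ) → ℝ := fun z => (∑ i, (z.1 i - z.2 i) ^ 2) / d
  have hd' : (0 : ℝ) < d := by exact_mod_cast hd
  have hn' : (0 : ℝ) < (n : ℝ) - 1 := by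
    have : (2 : ℝ) ≤ n := by exact_mod_cast hn
    linarith
  have hg : Measurable g := by
    simp only [g]
    fun_prop
  have hmem : ∀ᵐ z ∂P.prod P, g z ∈ Set.Icc (0 : ℝ) 1 := by
    filter_upwards [Measure.quasiMeasurePreserving_fst.ae hP_supp,
      Measure.quasiMeasurePreserving_snd.ae hP_supp] with z h1 h2
    refine ⟨by positivity, (div_le_one hd').2 ?_⟩
    have hle : ∀ i ∈ (Finset.univ : Finset (Fin d)), (z.1 i - z.2 i) ^ 2 ≤ 1 := fun i _ => by
      rw [sq_le_one_iff_abs_le_one, abs_le]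
      constructor <;> linarith [(h1 i).1, (h1 i).2, (h2 i).1, (h2 i).2]
    simpa using Finset.sum_le_card_nsmul _ _ 1 hle
  have hLp (i : Fin d) : MemLp (fun x : Fin d → ℝ => x i) 2 P :=
    memLp_of_bounded (hP_supp.mono fun x hx => hx i)
      (measurable_pi_apply i).aestronglyMeasurable 2
  have hmean : (P.prod P)[g] = 2 * (trSigma / d) := by
    have hint (i : Fin d) :
        Integrable (fun z : (Fin d → ℝ) × (Fin d → ℝ) => (z.1 i - z.2 i) ^ 2) (P.prod P) :=
      (((hLp i).comp_fst P).sub ((hLp i).comp_snd P)).integrable_sq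
    simp only [g]
    rw [integral_div, integral_finsetSum _ fun i _ => hint i, htrSigma,
      Finset.sum_congr rfl fun i _ => integral_prod_sub_sq P (hLp i), ← Finset.mul_sum,
      mul_div_assoc]
  have hU (ω : Fin n → Fin d → ℝ) : uStatistic g ω = 2 * (trHat ω / d) := by
    rw [htrHat, uStatistic_mean_sq_eq]
  have hL : 0 < Real.log (1 / δ) := Real.log_pos (one_lt_one_div hδ.1 hδ.2)
  set L := Real.log (1 / δ) with hLdef
  have hr : 0 < 2 * L / ((n : ℝ) - 1) := by positivity
  have htail := measureReal_sqrt_uStatistic_le hn P hg hmem hb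
    (q := Real.sqrt 2 * Real.sqrt (2 * L / ((n : ℝ) - 1))) (by positivity)
  have hset : {ω | Real.sqrt 2 * Real.sqrt (2 * L / ((n : ℝ) - 1)) <
        b * (Real.sqrt (P.prod P)[g] - Real.sqrt (uStatistic g ω))} =
      {ω | Real.sqrt (2 * L / ((n : ℝ) - 1)) <
        b * (Real.sqrt (trSigma / d) - Real.sqrt (trHat ω / d))} := by
    ext ω
    rw [Set.mem_ofPred_eq, Set.mem_ofPred_eq, hmean, hU, Real.sqrt_mul zero_le_two,
      Real.sqrt_mul zero_le_two, ← mul_sub, mul_left_comm b, mul_lt_mul_iff_right₀ (by positivity)]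
  rw [hset] at htail
  rw [← ofReal_measureReal]
  refine ENNReal.ofReal_le_ofReal (htail.trans ?_)
  have hhalf : (n : ℝ) - 1 ≤ 2 * (n / 2 : ℕ) := by
    have : n ≤ 2 * (n / 2) + 1 := by omega
    have : (n : ℝ) ≤ 2 * (n / 2 : ℕ) + 1 := by exact_mod_cast this
    linarith
  have hexponent : L ≤ (n / 2 : ℕ) * (Real.sqrt 2 * Real.sqrt (2 * L / ((n : ℝ) - 1))) ^ 2 := by
    rw [mul_pow, Real.sq_sqrt zero_le_two, Real.sq_sqrt hr.le]
    calc L ≤ ((n : ℝ) - 1) / 2 * (2 * (2 * L / ((n : ℝ) - 1))) := by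
          field_simp
          linarith
      _ ≤ _ := by gcongr; linarith
  calc _ ≤ Real.exp (-L) := by gcongr
    _ = δ := by rw [hLdef, one_div, Real.log_inv, neg_neg, Real.exp_log hδ.1]
end

section
/- Let ψ : ℝ^d → ℝ be bounded and even with ψ(0) = sup ψ =: ψ̄, ψ̲ := inf ψ, and Δψ := ψ̄ − ψ̲ > 0, and for x = (x_1, …, x_n) ∈ (ℝ^d)^n (n ≥ 2) define v̂(x) = ψ̄ − (1/(n(n−1))) Σ_{t≠s} ψ(x_t − x_s). Then the function x ↦ (n/(2Δψ)) v̂(x) is weakly (2, 0)-self-bounding and has the bounded differences property. -/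
open MeasureTheory

/-- A sum over ordered pairs of distinct indices is the double sum when the diagonal vanishes. -/
lemma sum_offDiag_eq_sum_sum {ι M : Type*} [Fintype ι] [DecidableEq ι] [AddCommMonoid M]
    (g : ι → ι → M) (hg : ∀ i, g i i = 0) :
    ∑ p ∈ Finset.univ.offDiag, g p.1 p.2 = ∑ i, ∑ j, g i j := by
  rw [← Finset.sum_product', Finset.univ_product_univ]
  refine Finset.sum_subset (Finset.subset_univ _) fun p _ hp => ?_
  have h : p.1 = p.2 := by simpa using hp
  rw [h, hg]

/-- Changing the `k`-th point of a nonnegative symmetric pair interaction lowers the total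
interaction by at most twice the interaction with the `k`-th point. -/
lemma sum_sum_le_sum_sum_update_add {ι E : Type*} [Fintype ι] [DecidableEq ι]
    (g : E → E → ℝ) (hg : ∀ u v, 0 ≤ g u v) (hsymm : ∀ u v, g u v = g v u)
    (x : ι → E) (k : ι) (y : E) :
    ∑ i, ∑ j, g (x i) (x j) ≤
      ∑ i, ∑ j, g (Function.update x k y i) (Function.update x k y j) +
        2 * ∑ j, g (x k) (x j) := by
  have hterm : ∀ i j, g (x i) (x j) ≤
      g (Function.update x k y i) (Function.update x k y j) +
        ((if i = k then g (x k) (x j) else 0) + (if j = k then g (x k) (x i) else 0)) := by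
    intro i j
    have h := hg (Function.update x k y i) (Function.update x k y j)
    by_cases hi : i = k
    · subst hi
      have h' : 0 ≤ if j = i then g (x i) (x i) else 0 := by
        split_ifs <;> simp [hg]
      simp only [if_true]
      linarith
    · by_cases hj : j = k
      · subst hj
        simp only [hi, if_true, if_false]
        linarith [hsymm (x i) (x j)]
      · simp [hi, hj]
  calc ∑ i, ∑ j, g (x i) (x j)
      ≤ ∑ i, ∑ j, (g (Function.update x k y i) (Function.update x k y j) +
        ((if i = k then g (x k) (x j) else 0) + (if j = k then g (x k) (x i) else 0))) :=
        Finset.sum_le_sum fun i _ => Finset.sum_le_sum fun j _ => hterm i j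
    _ = _ := by
        simp only [Finset.sum_add_distrib]
        rw [Finset.sum_comm (f := fun i j => if i = k then g (x k) (x j) else 0)]
        simp only [Finset.sum_ite_eq', Finset.mem_univ, if_true]
        ring

/-- For a bounded even function `ψ` with `ψ(0) = sup ψ` and
`Δψ = sup ψ − inf ψ > 0`, the rescaled empirical variance proxy
`x ↦ (n/(2Δψ)) v̂(x)`, with `v̂(x) = ψ̄ − (1/(n(n−1))) Σ_{t≠s} ψ(x_t − x_s)`,
is weakly `(2, 0)`-self-bounding and has the bounded differences property. -/
theorem translation_invariant_proxy_self_bounding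
    (d n : ℕ) (hn : 2 ≤ n)
    (ψ : (Fin d → ℝ) → ℝ)
    (hψ_even : ∀ y, ψ (-y) = ψ y)
    (hψ_sup : ∀ y, ψ y ≤ ψ 0)
    (ψInf : ℝ) (hψInf : IsGLB (Set.range ψ) ψInf)
    (Δψ : ℝ) (hΔψ : Δψ = ψ 0 - ψInf) (hΔψ_pos : 0 < Δψ)
    (vhat : (Fin n → Fin d → ℝ) → ℝ)
    (hvhat : ∀ x, vhat x = ψ 0 - (1 / ((n : ℝ) * ((n : ℝ) - 1))) *
      ∑ p ∈ Finset.univ.offDiag, ψ (x p.1 - x p.2))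
    (f : (Fin n → Fin d → ℝ) → ℝ)
    (hf : ∀ x, f x = ((n : ℝ) / (2 * Δψ)) * vhat x) :
    (∀ x, ∑ t₀ : Fin n,
        (f x - ⨅ x' : Fin d → ℝ, f (Function.update x t₀ x')) ^ 2 ≤ 2 * f x + 0) ∧
    (∀ x, ∀ t₀ : Fin n,
        f x - (⨅ x' : Fin d → ℝ, f (Function.update x t₀ x')) ≤ 1) := by
  have hn2 : (2 : ℝ) ≤ n := by exact_mod_cast hn
  have hn1 : 0 < (n : ℝ) - 1 := by linarith
  have hn0 : (n : ℝ) ≠ 0 := by linarith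
  set g : (Fin d → ℝ) → (Fin d → ℝ) → ℝ := fun u v => ψ 0 - ψ (u - v) with hg_def
  have hg_nonneg : ∀ u v, 0 ≤ g u v := fun u v => sub_nonneg.2 (hψ_sup _)
  have hg_symm : ∀ u v, g u v = g v u := fun u v => by
    simp only [hg_def]
    rw [← hψ_even (u - v), neg_sub]
  have hg_self : ∀ u, g u u = 0 := fun u => by simp [hg_def]
  have hg_le : ∀ u v, g u v ≤ Δψ := fun u v => by
    have := hψInf.1 (Set.mem_range_self (u - v))
    simp only [hg_def]
    linarith
  have hf_eq : ∀ x, f x = (∑ i, ∑ j, g (x i) (x j)) / (2 * (Δψ * (n - 1))) := by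
    intro x
    have hcard : ((Finset.univ : Finset (Fin n)).offDiag.card : ℝ) = n * (n - 1) := by
      rw [Finset.offDiag_card, Finset.card_univ, Fintype.card_fin,
        Nat.cast_sub (Nat.le_mul_self n)]
      push_cast
      ring
    rw [hf, hvhat, ← sum_offDiag_eq_sum_sum (fun i j => g (x i) (x j)) fun i => hg_self _]
    simp only [hg_def, Finset.sum_sub_distrib, Finset.sum_const, nsmul_eq_mul, hcard]
    field_simp
  set h : (Fin n → Fin d → ℝ) → Fin n → ℝ :=
    fun x k => (∑ j, g (x k) (x j)) / (Δψ * (n - 1)) with hh_def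
  have hden : 0 < Δψ * ((n : ℝ) - 1) := mul_pos hΔψ_pos hn1
  have hh_le_one : ∀ x k, h x k ≤ 1 := by
    intro x k
    rw [hh_def, div_le_one hden, ← Finset.add_sum_erase _ _ (Finset.mem_univ k), hg_self, zero_add]
    refine (Finset.sum_le_card_nsmul _ _ Δψ fun j _ => hg_le _ _).trans_eq ?_
    rw [Finset.card_erase_of_mem (Finset.mem_univ k), Finset.card_univ, Fintype.card_fin,
      nsmul_eq_mul, Nat.cast_sub (by omega), Nat.cast_one, mul_comm]
  have hsum : ∀ x, ∑ k, h x k = 2 * f x := by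
    intro x
    rw [hf_eq, hh_def, ← Finset.sum_div]
    field_simp
  have hf_nonneg : ∀ x, 0 ≤ f x := fun x => by
    rw [hf_eq]
    exact div_nonneg (Finset.sum_nonneg fun i _ => Finset.sum_nonneg fun j _ => hg_nonneg _ _)
      (by positivity)
  have hdrop_nonneg : ∀ x k, 0 ≤ f x - ⨅ y : Fin d → ℝ, f (Function.update x k y) := by
    intro x k
    have hbdd : BddBelow (Set.range fun y : Fin d → ℝ => f (Function.update x k y)) :=
      ⟨0, by rintro _ ⟨y, rfl⟩; exact hf_nonneg _⟩
    have := ciInf_le hbdd (x k)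
    rw [Function.update_eq_self] at this
    linarith
  have hdrop_le : ∀ x k, f x - (⨅ y : Fin d → ℝ, f (Function.update x k y)) ≤ h x k := by
    intro x k
    rw [sub_le_comm]
    refine le_ciInf fun y => ?_
    have hh : h x k = 2 * (∑ j, g (x k) (x j)) / (2 * (Δψ * (n - 1))) :=
      (mul_div_mul_left _ _ two_ne_zero).symm
    rw [sub_le_iff_le_add, hf_eq x, hf_eq, hh, ← add_div]
    exact div_le_div_of_nonneg_right
      (sum_sum_le_sum_sum_update_add g hg_nonneg hg_symm x k y) (by positivity)
  refine ⟨fun x => ?_, fun x k => (hdrop_le x k).trans (hh_le_one x k)⟩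
  rw [add_zero, ← hsum]
  refine Finset.sum_le_sum fun k _ => ?_
  have h₀ := hdrop_nonneg x k
  have h₁ := hdrop_le x k
  exact (pow_le_of_le_one h₀ (h₁.trans (hh_le_one x k)) two_ne_zero).trans h₁
end

section
/- Let ψ : ℝ^d → ℝ be a bounded even measurable function with ψ(0) = sup ψ =: ψ̄ and Δψ := ψ̄ − inf ψ > 0, X_1, …, X_n i.i.d. from a probability measure P on ℝ^d (n ≥ 2), v = ψ̄ − E_{X,X'∼P}[ψ(X − X')] and v̂ = ψ̄ − (1/(n(n−1))) Σ_{t≠s} ψ(X_t − X_s). Then for each b ∈ {−1, 1} and δ ∈ (0,1), with probability at least 1 − δ: b·(√v̂ − √v) ≤ 2 √(2 Δψ log(1/δ)/n). -/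
open MeasureTheory ProbabilityTheory

theorem integral_prod_pairs_of_iIndepFun {Ω α κ : Type*} [MeasurableSpace Ω] [MeasurableSpace α]
    {μ : Measure Ω} {Y : κ × Bool → Ω → α} (hY : iIndepFun Y μ) (hYm : ∀ p, Measurable (Y p))
    {g : α × α → ℝ} (hg : Measurable g) (s : Finset κ) :
    ∫ ω, ∏ i ∈ s, g (Y (i, false) ω, Y (i, true) ω) ∂μ =
      ∏ i ∈ s, ∫ ω, g (Y (i, false) ω, Y (i, true) ω) ∂μ := by
  classical
  have := hY.isProbabilityMeasure
  induction s using Finset.induction_on with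
  | empty => simp
  | insert a s ha ih =>
    simp_rw [Finset.prod_insert ha]
    rw [← ih]
    have hdisj : Disjoint (({a} : Finset κ) ×ˢ (Finset.univ : Finset Bool))
        (s ×ˢ (Finset.univ : Finset Bool)) := by
      rw [Finset.disjoint_left]
      rintro ⟨i, j⟩ h1 h2
      simp only [Finset.mem_product, Finset.mem_singleton, Finset.mem_univ, and_true] at h1 h2
      exact ha (h1 ▸ h2)
    have hind := hY.indepFun_finset _ _ hdisj hYm
    let G : ((({a} : Finset κ) ×ˢ (Finset.univ : Finset Bool) : Finset (κ × Bool)) → α) → ℝ :=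
      fun x => g (x ⟨(a, false), by simp⟩, x ⟨(a, true), by simp⟩)
    let H : ((s ×ˢ (Finset.univ : Finset Bool) : Finset (κ × Bool)) → α) → ℝ :=
      fun x => ∏ i : s, g (x ⟨(i, false), by simp⟩, x ⟨(i, true), by simp⟩)
    have hG : Measurable G := by fun_prop
    have hH : Measurable H := by fun_prop
    have hGH := hind.comp hG hH
    have hH' : ∀ ω, ∏ i ∈ s, g (Y (i, false) ω, Y (i, true) ω) =
        H (fun p => Y p ω) := fun ω =>
      (Finset.prod_coe_sort s fun i => g (Y (i, false) ω, Y (i, true) ω)).symm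
    simp_rw [hH']
    refine hGH.integral_mul_eq_mul_integral ?_ ?_
    · exact (hG.comp (measurable_pi_lambda _ fun p => hYm p)).aestronglyMeasurable
    · exact (hH.comp (measurable_pi_lambda _ fun p => hYm p)).aestronglyMeasurable

theorem integral_pi_prod_pairs {ι κ α : Type*} [Fintype ι] [Fintype κ] [MeasurableSpace α]
    (P : Measure α) [IsProbabilityMeasure P] {e : κ × Bool → ι} (he : Function.Injective e)
    {g : α × α → ℝ} (hg : Measurable g) :
    ∫ x, ∏ i, g (x (e (i, false)), x (e (i, true))) ∂(Measure.pi fun _ : ι => P) =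
      (∫ p, g p ∂(P.prod P)) ^ Fintype.card κ := by
  have hX : iIndepFun (fun (j : ι) (x : ι → α) => x j) (Measure.pi fun _ : ι => P) :=
    iIndepFun_pi (X := fun _ x => x) fun _ => aemeasurable_id
  have hY := hX.precomp he
  have hYm : ∀ p, Measurable (fun x : ι → α => x (e p)) := fun p => measurable_pi_apply _
  have key := integral_prod_pairs_of_iIndepFun hY hYm hg Finset.univ
  refine key.trans ?_
  rw [Finset.prod_eq_pow_card (b := ∫ p, g p ∂(P.prod P)), Finset.card_univ]
  intro i _
  have hne : (i, false) ≠ (i, true) := by simp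
  have hmap := (hY.indepFun hne).map_prod_eq_prod_map_map
    (hYm _).aemeasurable (hYm _).aemeasurable
  have hev : ∀ p, (Measure.pi fun _ : ι => P).map (fun x : ι → α => x (e p)) = P := fun p =>
    (measurePreserving_eval (fun _ : ι => P) (e p)).map_eq
  change Measure.map (fun x : ι → α => (x (e (i, false)), x (e (i, true)))) _ =
    (Measure.map (fun x : ι → α => x (e (i, false))) _).prod
      (Measure.map (fun x : ι → α => x (e (i, true))) _) at hmap
  rw [hev, hev] at hmap
  rw [← hmap, integral_map (by fun_prop) hg.aestronglyMeasurable]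

theorem integral_exp_mul_le_of_mem_Icc {Ω : Type*} [MeasurableSpace Ω] {μ : Measure Ω}
    [IsProbabilityMeasure μ] {q : Ω → ℝ} (hq : Measurable q) {Δ : ℝ} (hΔ : 0 < Δ)
    (hmem : ∀ ω, q ω ∈ Set.Icc 0 Δ) (c : ℝ) :
    ∫ ω, Real.exp (c * q ω) ∂μ ≤ Real.exp ((∫ ω, q ω ∂μ) / Δ * (Real.exp (c * Δ) - 1)) := by
  have hqi : Integrable q μ := Integrable.of_mem_Icc 0 Δ hq.aemeasurable (ae_of_all _ hmem)
  have hpt : ∀ ω, Real.exp (c * q ω) ≤ 1 + q ω / Δ * (Real.exp (c * Δ) - 1) := by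
    intro ω
    have h := convexOn_exp.2 (Set.mem_univ 0) (Set.mem_univ (c * Δ)) (sub_nonneg.2 ((div_le_one hΔ).2 (hmem ω).2))
      (div_nonneg (hmem ω).1 hΔ.le) (by ring)
    have h2 : (1 - q ω / Δ) • (0 : ℝ) + (q ω / Δ) • (c * Δ) = c * q ω := by
      simp only [smul_eq_mul]; field_simp; ring
    rw [h2] at h
    simp only [smul_eq_mul, Real.exp_zero] at h
    linarith
  have hi2 : Integrable (fun ω => q ω / Δ * (Real.exp (c * Δ) - 1)) μ :=
    (hqi.div_const _).mul_const _
  calc ∫ ω, Real.exp (c * q ω) ∂μ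
      ≤ ∫ ω, (1 + q ω / Δ * (Real.exp (c * Δ) - 1)) ∂μ :=
        integral_mono_of_nonneg (ae_of_all _ fun ω => (Real.exp_pos _).le)
          ((integrable_const _).add hi2) (ae_of_all _ hpt)
    _ = (∫ ω, q ω ∂μ) / Δ * (Real.exp (c * Δ) - 1) + 1 := by
        rw [integral_add (integrable_const _) hi2, integral_mul_const, integral_div]
        simp [add_comm]
    _ ≤ _ := Real.add_one_le_exp _

/-- The mean of a kernel over all ordered pairs of distinct sample points. -/
noncomputable def pairMean {n : ℕ} {α : Type*} (q : α × α → ℝ) (x : Fin n → α) : ℝ :=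
  (1 / ((n : ℝ) * ((n : ℝ) - 1))) * ∑ p ∈ Finset.univ.offDiag, q (x p.1, x p.2)

theorem measurable_pairMean {n : ℕ} {α : Type*} [MeasurableSpace α] {q : α × α → ℝ}
    (hq : Measurable q) : Measurable (pairMean (n := n) q) := by
  unfold pairMean
  fun_prop

theorem card_offDiag_univ_fin (n : ℕ) :
    ((Finset.univ : Finset (Fin n)).offDiag.card : ℝ) = (n : ℝ) * ((n : ℝ) - 1) := by
  rw [Finset.offDiag_card, Finset.card_univ, Fintype.card_fin, Nat.cast_sub (Nat.le_mul_self n)]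
  push_cast
  ring

theorem pairMean_mem_Icc {n : ℕ} (hn : 2 ≤ n) {α : Type*} {q : α × α → ℝ} {Δ : ℝ}
    (hmem : ∀ p, q p ∈ Set.Icc 0 Δ) (x : Fin n → α) : pairMean q x ∈ Set.Icc 0 Δ := by
  have hn' : (2 : ℝ) ≤ n := by exact_mod_cast hn
  have hpos : 0 < (n : ℝ) * ((n : ℝ) - 1) := by nlinarith
  unfold pairMean
  constructor
  · exact mul_nonneg (by positivity) (Finset.sum_nonneg fun p _ => (hmem _).1)
  · have := Finset.sum_le_card_nsmul Finset.univ.offDiag (fun p : Fin n × Fin n => q (x p.1, x p.2))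
      Δ fun p _ => (hmem _).2
    rw [nsmul_eq_mul, card_offDiag_univ_fin] at this
    rw [one_div, inv_mul_le_iff₀ hpos]
    exact this

/-- Hoeffding's representation of a second-order U-statistic as a mean over permutations of
means over disjoint pairs. -/
theorem pairMean_eq_mean_perm {n m : ℕ} (hn : 2 ≤ n) (hm : 0 < m) {α : Type*}
    {e : Fin m × Bool → Fin n} (he : Function.Injective e) (q : α × α → ℝ) (x : Fin n → α) :
    pairMean q x = ∑ σ : Equiv.Perm (Fin n), (1 / (Fintype.card (Equiv.Perm (Fin n)) : ℝ)) *
      ((1 / (m : ℝ)) * ∑ i, q (x (σ (e (i, false))), x (σ (e (i, true))))) := by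
  have hn' : (2 : ℝ) ≤ n := by exact_mod_cast hn
  have hpos : (0 : ℝ) < (n : ℝ) * ((n : ℝ) - 1) := by nlinarith
  have hm' : (0 : ℝ) < m := by exact_mod_cast hm
  have hN : (0 : ℝ) < (Fintype.card (Equiv.Perm (Fin n)) : ℝ) := by
    exact_mod_cast Fintype.card_pos
  rw [← Finset.mul_sum, ← Finset.mul_sum, Finset.sum_comm]
  have h : ∀ i : Fin m, ∑ σ : Equiv.Perm (Fin n),
      q (x (σ (e (i, false))), x (σ (e (i, true)))) =
      (Fintype.card (Equiv.Perm (Fin n)) : ℝ) * pairMean q x := by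
    intro i
    have := card_offDiag_mul_sum_perm (fun s t => q (x s, x t))
      (a := e (i, false)) (b := e (i, true)) (he.ne (by simp))
    rw [card_offDiag_univ_fin] at this
    unfold pairMean
    rw [← mul_right_inj' hpos.ne', this]
    generalize ∑ p ∈ Finset.univ.offDiag, q (x p.1, x p.2) = S
    have h1 : (n : ℝ) - 1 ≠ 0 := by linarith
    field_simp
  rw [Finset.sum_congr rfl fun i _ => h i, Finset.sum_const, Finset.card_univ, Fintype.card_fin,
    nsmul_eq_mul]
  field_simp

theorem integral_exp_mul_pairMean_le {n m : ℕ} (hn : 2 ≤ n) (hm : 0 < m) {α : Type*}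
    [MeasurableSpace α] (P : Measure α) [IsProbabilityMeasure P]
    {e : Fin m × Bool → Fin n} (he : Function.Injective e)
    {q : α × α → ℝ} (hq : Measurable q) {Δ : ℝ} (hΔ : 0 < Δ)
    (hmem : ∀ p, q p ∈ Set.Icc 0 Δ) (c : ℝ) :
    ∫ x, Real.exp (m * c * pairMean q x) ∂(Measure.pi fun _ : Fin n => P) ≤
      Real.exp (m * ((∫ p, q p ∂(P.prod P)) / Δ * (Real.exp (c * Δ) - 1))) := by
  have hm' : (0 : ℝ) < m := by exact_mod_cast hm
  set N : ℝ := (Fintype.card (Equiv.Perm (Fin n)) : ℝ) with hN_def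
  have hN : 0 < N := by rw [hN_def]; exact_mod_cast Fintype.card_pos
  let F : Equiv.Perm (Fin n) → (Fin n → α) → ℝ := fun σ x =>
    ∏ i, Real.exp (c * q (x (σ (e (i, false))), x (σ (e (i, true)))))
  have hFm : ∀ σ, Measurable (F σ) := by intro σ; fun_prop
  have hexp : ∀ p, Real.exp (c * q p) ∈ Set.Icc 0 (Real.exp (|c| * Δ)) := fun p =>
    ⟨(Real.exp_pos _).le, Real.exp_le_exp.2 <|
      mul_le_mul (le_abs_self c) (hmem p).2 (hmem p).1 (abs_nonneg c)⟩
  have hFi : ∀ σ, Integrable (F σ) (Measure.pi fun _ : Fin n => P) := fun σ =>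
    Integrable.of_mem_Icc 0 (Real.exp (|c| * Δ) ^ m) (hFm σ).aemeasurable <|
      ae_of_all _ fun x => ⟨Finset.prod_nonneg fun i _ => (hexp _).1, by
        simpa using Finset.prod_le_prod (s := Finset.univ) (fun i _ => (hexp
          (x (σ (e (i, false))), x (σ (e (i, true))))).1) fun i _ => (hexp _).2⟩
  have hpt : ∀ x : Fin n → α, Real.exp (m * c * pairMean q x) ≤ ∑ σ, (1 / N) * F σ x := by
    intro x
    have h := convexOn_exp.map_sum_le (t := Finset.univ) (w := fun _ : Equiv.Perm (Fin n) => 1 / N)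
      (p := fun σ => ∑ i, c * q (x (σ (e (i, false))), x (σ (e (i, true)))))
      (fun _ _ => by positivity)
      (by
        rw [Finset.sum_const, Finset.card_univ, nsmul_eq_mul]
        exact mul_one_div_cancel hN.ne')
      (fun _ _ => Set.mem_univ _)
    simp only [smul_eq_mul] at h
    have hF : ∀ σ, F σ x =
        Real.exp (∑ i, c * q (x (σ (e (i, false))), x (σ (e (i, true))))) :=
      fun σ => (Real.exp_sum _ _).symm
    simp_rw [hF]
    refine le_trans (le_of_eq ?_) h
    rw [pairMean_eq_mean_perm hn hm he q x, Finset.mul_sum]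
    congr 1
    refine Finset.sum_congr rfl fun σ _ => ?_
    rw [← Finset.mul_sum, ← hN_def]
    field_simp
  have hint : ∀ σ, ∫ x, F σ x ∂(Measure.pi fun _ : Fin n => P) =
      (∫ p, Real.exp (c * q p) ∂(P.prod P)) ^ m := by
    intro σ
    have := integral_pi_prod_pairs P (σ.injective.comp he)
      (g := fun p => Real.exp (c * q p)) (by fun_prop)
    simpa using this
  calc _ ≤ ∫ x, ∑ σ, (1 / N) * F σ x ∂(Measure.pi fun _ : Fin n => P) :=
        integral_mono_of_nonneg (ae_of_all _ fun x => (Real.exp_pos _).le)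
          (integrable_finsetSum _ fun σ _ => (hFi σ).const_mul _) (ae_of_all _ hpt)
    _ = (∫ p, Real.exp (c * q p) ∂(P.prod P)) ^ m := by
        rw [integral_finsetSum _ fun σ _ => (hFi σ).const_mul _]
        simp_rw [integral_const_mul, hint]
        rw [Finset.sum_const, Finset.card_univ, nsmul_eq_mul, ← mul_assoc,
          mul_one_div_cancel hN.ne', one_mul]
    _ ≤ _ := by
        rw [Real.exp_nat_mul]
        exact pow_le_pow_left₀ (integral_nonneg fun p => (Real.exp_pos _).le)
          (integral_exp_mul_le_of_mem_Icc hq hΔ hmem c) m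

/-- The Chernoff exponent of a Poisson-type log-Laplace bound dominates the squared Hellinger
distance between the means `s ^ 2` and `t ^ 2`. -/
theorem sq_sub_le_chernoff_exponent {s t : ℝ} (hs : 0 ≤ s) (ht : 0 < t) :
    (t - s) ^ 2 ≤ (t - s) / t * t ^ 2 - s ^ 2 * (Real.exp ((t - s) / t) - 1) := by
  have h1 : s ≤ t * Real.exp (-((t - s) / t)) := by
    have := mul_le_mul_of_nonneg_left (Real.add_one_le_exp (-((t - s) / t))) ht.le
    have h2 : t * (-((t - s) / t) + 1) = s := by field_simp; ring
    linarith
  have h2 : s * Real.exp ((t - s) / t) ≤ t := by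
    have := mul_le_mul_of_nonneg_right h1 (Real.exp_pos ((t - s) / t)).le
    rwa [mul_assoc, ← Real.exp_add, neg_add_cancel, Real.exp_zero, mul_one] at this
  have h3 : (t - s) / t * t ^ 2 = (t - s) * t := by field_simp
  rw [h3]
  nlinarith [mul_le_mul_of_nonneg_left h2 hs]

theorem exists_injective_pairs (n : ℕ) :
    ∃ e : Fin (n / 2) × Bool → Fin n, Function.Injective e := by
  refine ⟨_, (Function.Embedding.nonempty_of_card_le ?_).some.injective⟩
  simp
  omega

/-- One-sided deviation of the square root of a bounded nonnegative U-statistic of order two. -/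
theorem measure_sqrt_pairMean_deviation_le {n : ℕ} (hn : 2 ≤ n) {α : Type*}
    [MeasurableSpace α] (P : Measure α) [IsProbabilityMeasure P]
    {q : α × α → ℝ} (hq : Measurable q) {Δ : ℝ} (hΔ : 0 < Δ)
    (hmem : ∀ p, q p ∈ Set.Icc 0 Δ) {b : ℝ} (hb : b = -1 ∨ b = 1) {r : ℝ} (hr : 0 < r) :
    (Measure.pi fun _ : Fin n => P).real
      {x | r < b * (√(pairMean q x) - √(∫ p, q p ∂(P.prod P)))} ≤
      Real.exp (-(((n / 2 : ℕ) : ℝ) / Δ * r ^ 2)) := by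
  set v := ∫ p, q p ∂(P.prod P) with hv
  set m := n / 2 with hm_def
  have hm : 0 < m := by omega
  obtain ⟨e, he⟩ := exists_injective_pairs n
  have hv0 : 0 ≤ v := integral_nonneg fun p => (hmem p).1
  set s := √v with hs_def
  have hs : 0 ≤ s := Real.sqrt_nonneg v
  have hs2 : s ^ 2 = v := Real.sq_sqrt hv0
  set t := s + b * r with ht_def
  have hb2 : b * b = 1 := by rcases hb with rfl | rfl <;> norm_num
  rcases le_or_gt t 0 with ht | ht
  · have hempty : {x : Fin n → α | r < b * (√(pairMean q x) - s)} = ∅ := by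
      refine Set.eq_empty_of_forall_notMem fun x hx => ?_
      have hx' : r < b * (√(pairMean q x) - s) := hx
      have := Real.sqrt_nonneg (pairMean q x)
      rcases hb with rfl | rfl <;> linarith
    rw [hempty, measureReal_empty]
    positivity
  set c := (t - s) / t / Δ with hc
  have hcΔ : c * Δ = (t - s) / t := by rw [hc]; field_simp
  have hts : t - s = b * r := by rw [ht_def]; ring
  have hsub : {x : Fin n → α | r < b * (√(pairMean q x) - s)} ⊆
      {x | Real.exp (m * c * t ^ 2) ≤ Real.exp (m * c * pairMean q x)} := by
    intro x hx
    have hx' : r < b * (√(pairMean q x) - s) := hx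
    have h0 := (pairMean_mem_Icc hn hmem x).1
    have hsq := Real.sq_sqrt h0
    have hnn := Real.sqrt_nonneg (pairMean q x)
    have hcb : 0 ≤ b * c := by
      have : b * c = r / t / Δ := by
        rw [hc, hts, ← mul_div_assoc, ← mul_div_assoc, ← mul_assoc, hb2, one_mul]
      rw [this]; positivity
    have hdiff : 0 ≤ b * (pairMean q x - t ^ 2) := by
      rcases hb with rfl | rfl <;> nlinarith
    have : 0 ≤ c * (pairMean q x - t ^ 2) := by
      have h := mul_nonneg hcb hdiff
      have h' : b * c * (b * (pairMean q x - t ^ 2)) = (b * b) * (c * (pairMean q x - t ^ 2)) := by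
        ring
      rwa [h', hb2, one_mul] at h
    have hmm := mul_nonneg (Nat.cast_nonneg (α := ℝ) m) this
    exact Real.exp_le_exp.2 (by linarith)
  have hint : Integrable (fun x => Real.exp (m * c * pairMean q x))
      (Measure.pi fun _ : Fin n => P) :=
    Integrable.of_mem_Icc 0 (Real.exp (|m * c| * Δ))
      (((measurable_pairMean hq).const_mul _).exp).aemeasurable <| ae_of_all _ fun x =>
        ⟨(Real.exp_pos _).le, Real.exp_le_exp.2 <| mul_le_mul (le_abs_self _)
          (pairMean_mem_Icc hn hmem x).2 (pairMean_mem_Icc hn hmem x).1 (abs_nonneg _)⟩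
  have hmarkov := mul_meas_ge_le_integral_of_nonneg
    (ae_of_all _ fun x => (Real.exp_pos (m * c * pairMean q x)).le) hint
    (Real.exp (m * c * t ^ 2))
  have hmgf := integral_exp_mul_pairMean_le hn hm P he hq hΔ hmem c
  refine (measureReal_mono hsub).trans ?_
  have h1 := hmarkov.trans hmgf
  rw [← le_div_iff₀' (Real.exp_pos _), ← Real.exp_sub] at h1
  refine h1.trans (Real.exp_le_exp.2 ?_)
  have hkey := sq_sub_le_chernoff_exponent hs ht
  have hr2 : (t - s) ^ 2 = r ^ 2 := by rw [hts, mul_pow, sq b, hb2, one_mul]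
  rw [hr2, hs2, ← hcΔ] at hkey
  have hmΔ : 0 ≤ (m : ℝ) / Δ := by positivity
  have := mul_le_mul_of_nonneg_left hkey hmΔ
  have hexpand : (m : ℝ) / Δ * (c * Δ * t ^ 2 - v * (Real.exp (c * Δ) - 1)) =
      m * c * t ^ 2 - m * (v / Δ * (Real.exp (c * Δ) - 1)) := by field_simp
  rw [hexpand] at this
  linarith

/-- For a translation-invariant kernel given by a bounded even measurable
`ψ` with `ψ(0) = sup ψ` and `Δψ > 0`, for `b ∈ {−1,1}`, with probability at least `1 − δ`,
`b·(√v̂ − √v) ≤ 2√(2 Δψ log(1/δ)/n)`. -/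
theorem sqrt_empirical_variance_concentration_TI
    (d n : ℕ) (hn : 2 ≤ n)
    (ψ : (Fin d → ℝ) → ℝ) (hψ_meas : Measurable ψ)
    (hψ_even : ∀ y, ψ (-y) = ψ y)
    (hψ_sup : ∀ y, ψ y ≤ ψ 0)
    (ψInf : ℝ) (hψInf : IsGLB (Set.range ψ) ψInf)
    (Δψ : ℝ) (hΔψ : Δψ = ψ 0 - ψInf) (hΔψ_pos : 0 < Δψ)
    (P : Measure (Fin d → ℝ)) [IsProbabilityMeasure P]
    (v : ℝ) (hv : v = ψ 0 - ∫ p, ψ (p.1 - p.2) ∂(P.prod P))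
    (vhat : (Fin n → Fin d → ℝ) → ℝ)
    (hvhat : ∀ x, vhat x = ψ 0 - (1 / ((n : ℝ) * ((n : ℝ) - 1))) *
      ∑ p ∈ Finset.univ.offDiag, ψ (x p.1 - x p.2))
    (b : ℝ) (hb : b = -1 ∨ b = 1)
    (δ : ℝ) (hδ : δ ∈ Set.Ioo (0 : ℝ) 1) :
    ENNReal.ofReal (1 - δ) ≤
      (Measure.pi fun _ : Fin n => P)
        {ω | b * (Real.sqrt (vhat ω) - Real.sqrt v) ≤
          2 * Real.sqrt (2 * Δψ * Real.log (1 / δ) / n)} := by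
  have hn' : (2 : ℝ) ≤ n := by exact_mod_cast hn
  have hpos : (0 : ℝ) < (n : ℝ) * ((n : ℝ) - 1) := by nlinarith
  let q : (Fin d → ℝ) × (Fin d → ℝ) → ℝ := fun p => ψ 0 - ψ (p.1 - p.2)
  have hψq : Measurable fun p : (Fin d → ℝ) × (Fin d → ℝ) => ψ (p.1 - p.2) :=
    hψ_meas.comp (measurable_fst.sub measurable_snd)
  have hq : Measurable q := hψq.const_sub _
  have hmem : ∀ p, q p ∈ Set.Icc 0 Δψ := fun p =>
    ⟨sub_nonneg.2 (hψ_sup _), by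
      have := hψInf.1 (Set.mem_range_self (p.1 - p.2))
      simp only [q]
      linarith⟩
  have hvq : v = ∫ p, q p ∂(P.prod P) := by
    have hi : Integrable (fun p : (Fin d → ℝ) × (Fin d → ℝ) => ψ (p.1 - p.2)) (P.prod P) :=
      Integrable.of_mem_Icc ψInf (ψ 0) hψq.aemeasurable
        (ae_of_all _ fun p => ⟨hψInf.1 (Set.mem_range_self _), hψ_sup _⟩)
    rw [hv, integral_sub (integrable_const _) hi]
    simp
  have hvhatq : ∀ x, vhat x = pairMean q x := by
    intro x
    simp only [hvhat, pairMean, q, Finset.sum_sub_distrib, Finset.sum_const, nsmul_eq_mul,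
      card_offDiag_univ_fin]
    rw [mul_sub (1 / _), ← mul_assoc, one_div_mul_cancel hpos.ne', one_mul]
  set L := Real.log (1 / δ) with hL
  have hL0 : 0 < L := Real.log_pos (by rw [lt_div_iff₀ hδ.1]; linarith [hδ.2])
  set r := 2 * √(2 * Δψ * L / n) with hr_def
  have hr : 0 < r := by positivity
  have hr2 : r ^ 2 = 8 * Δψ * L / n := by
    rw [hr_def, mul_pow, Real.sq_sqrt (by positivity)]
    ring
  have hdev := measure_sqrt_pairMean_deviation_le hn P hq hΔψ_pos hmem hb hr
  have hexp : Real.exp (-(((n / 2 : ℕ) : ℝ) / Δψ * r ^ 2)) ≤ δ := by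
    have hδL : δ = Real.exp (-L) := by
      rw [hL, one_div, Real.log_inv, neg_neg, Real.exp_log hδ.1]
    have h3 : (n : ℝ) ≤ 3 * ((n / 2 : ℕ) : ℝ) := by
      have : n ≤ 3 * (n / 2) := by omega
      exact_mod_cast this
    conv_rhs => rw [hδL]
    refine Real.exp_le_exp.2 (neg_le_neg ?_)
    have heq : ((n / 2 : ℕ) : ℝ) / Δψ * r ^ 2 = 8 * ((n / 2 : ℕ) : ℝ) * L / n := by
      rw [hr2]; field_simp
    rw [heq, le_div_iff₀ (by linarith)]
    nlinarith
  have hset : {ω | b * (√(vhat ω) - √v) ≤ r} =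
      {x | r < b * (√(pairMean q x) - √(∫ p, q p ∂(P.prod P)))}ᶜ := by
    ext x
    simp [hvhatq, hvq]
  have hmeas : MeasurableSet
      {x : Fin n → Fin d → ℝ | r < b * (√(pairMean q x) - √(∫ p, q p ∂(P.prod P)))} :=
    measurableSet_lt measurable_const
      (((measurable_pairMean hq).sqrt.sub_const _).const_mul _)
  rw [hset, ← ofReal_measureReal, probReal_compl_eq_one_sub hmeas]
  exact ENNReal.ofReal_le_ofReal (by linarith)
end

section
/- (Empirical-variance high-confidence convergence rate, translation-invariant kernel.) Let X_1, …, X_n be i.i.d. from P (n ≥ 2) and δ ∈ (0,1). With probability at least 1 − δ: ‖μ̂_n − μ_P‖ ≤ √(2 v̂ log(2/δ)/n) + (16/3) √(Δψ) log(2/δ)/n, where v̂ = ψ̄ − (1/(n(n−1))) Σ_{t≠s} ψ(X_t − X_s). -/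
open MeasureTheory
open scoped RealInnerProductSpace

/-- `z ↦ cosh √z` is convex on `[0, ∞)`. -/
theorem cosh_le_of_sq_eq_convex_comb {p q r s t : ℝ} (hs : 0 ≤ s) (ht : 0 ≤ t) (hst : s + t = 1)
    (hr : r ^ 2 = s * p ^ 2 + t * q ^ 2) :
    Real.cosh r ≤ s * Real.cosh p + t * Real.cosh q := by
  refine hasSum_le (fun k => ?_) (Real.hasSum_cosh r)
    (((Real.hasSum_cosh p).mul_left s).add ((Real.hasSum_cosh q).mul_left t))
  have h := (convexOn_pow k).2 (Set.mem_Ici.2 (sq_nonneg p)) (Set.mem_Ici.2 (sq_nonneg q)) hs ht hst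
  simp only [smul_eq_mul] at h
  rw [← mul_div_assoc, ← mul_div_assoc, ← add_div, pow_mul, pow_mul, pow_mul, hr]
  gcongr

theorem exp_sub_id_le_of_lt_three {y B : ℝ} (hy : 0 ≤ y) (hyB : y ≤ B) (hB : B < 3) :
    Real.exp y - y ≤ 1 + y ^ 2 / (2 * (1 - B / 3)) := by
  have h1 := (NormedSpace.expSeries_div_hasSum_exp (𝔸 := ℝ) y)
  rw [← Real.exp_eq_exp_ℝ, ← hasSum_nat_add_iff' 2] at h1
  have h2 := (hasSum_geometric_of_lt_one (r := B / 3) (by linarith) (by linarith)).mul_left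
    (y ^ 2 / 2)
  have h3 := hasSum_le (fun k => ?_) h1 h2
  · simp [Finset.sum_range_succ] at h3
    rw [div_mul_eq_div_div, div_eq_mul_inv (y ^ 2 / 2)]
    linarith
  · have : (2 * 3 ^ k : ℝ) ≤ ((k + 2).factorial : ℝ) := by
      have := @Nat.factorial_mul_pow_le_factorial 2 k
      rw [add_comm k 2]
      exact_mod_cast this
    calc y ^ (k + 2) / ((k + 2).factorial : ℝ) ≤ (B ^ k * y ^ 2) / (2 * 3 ^ k) := by
          have hB0 : 0 ≤ B := hy.trans hyB
          rw [pow_add]; gcongr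
      _ = y ^ 2 / 2 * (B / 3) ^ k := by rw [div_pow]; ring

theorem integrable_cosh_norm_add_sum {H : Type*} [NormedAddCommGroup H]
    [SecondCountableTopology H] [MeasurableSpace H] [BorelSpace H]
    {E : Type*} [MeasurableSpace E] (P : Measure E) [IsProbabilityMeasure P] {ξ : E → H}
    (hξ : Measurable ξ) {B : ℝ}
    (hbound : ∀ x, ‖ξ x‖ ≤ B) (n : ℕ) (s : H) :
    Integrable (fun ω : Fin n → E => Real.cosh ‖s + ∑ i, ξ (ω i)‖) (Measure.pi fun _ => P) := by
  refine .of_bound (Measurable.aestronglyMeasurable ?_) (Real.cosh (‖s‖ + n * B))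
    (ae_of_all _ fun ω => ?_)
  · exact Real.continuous_cosh.measurable.comp
      (measurable_const.add
        (Finset.measurable_sum _ fun i _ => hξ.comp (measurable_pi_apply i))).norm
  · rw [Real.norm_of_nonneg (Real.cosh_pos _).le, Real.cosh_le_cosh, abs_norm]
    refine le_trans ?_ (le_abs_self _)
    refine (norm_add_le _ _).trans ?_
    gcongr
    refine (norm_sum_le_of_le _ fun i _ => hbound (ω i)).trans ?_
    simp

section Pinelis

variable {H : Type*} [NormedAddCommGroup H] [InnerProductSpace ℝ H]

/-- Second-order expansion of `cosh ‖·‖` around `s`, with an explicit remainder. -/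
theorem exists_cosh_norm_add_le (s : H) :
    ∃ c : H, ∀ ξ : H, Real.cosh ‖s + ξ‖ ≤ Real.cosh ‖s‖ * (Real.exp ‖ξ‖ - ‖ξ‖) + ⟪c, ξ⟫ := by
  refine ⟨(Real.sinh ‖s‖ / ‖s‖) • s, fun ξ => ?_⟩
  have hexp : Real.exp ‖ξ‖ = Real.cosh ‖ξ‖ + Real.sinh ‖ξ‖ := (Real.cosh_add_sinh _).symm
  have hsinh : ‖ξ‖ ≤ Real.sinh ‖ξ‖ := Real.self_le_sinh_iff.2 (norm_nonneg _)
  rcases eq_or_ne s 0 with rfl | hs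
  · simp only [zero_add, norm_zero, Real.cosh_zero, one_mul, Real.sinh_zero, zero_div, zero_smul,
      inner_zero_left, add_zero]
    linarith
  rcases eq_or_ne ξ 0 with rfl | hξ
  · simp
  have ha : 0 < ‖s‖ := norm_pos_iff.2 hs
  have hb : 0 < ‖ξ‖ := norm_pos_iff.2 hξ
  rw [inner_smul_left]
  simp only [conj_trivial]
  have hw := abs_le.1 (abs_real_inner_le_norm s ξ)
  have hsq := norm_add_sq_real s ξ
  generalize ⟪s, ξ⟫ = w at *
  generalize ‖s‖ = a at *
  generalize ‖ξ‖ = y at *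
  have hconv := cosh_le_of_sq_eq_convex_comb (r := ‖s + ξ‖) (p := a + y) (q := a - y)
    (s := (a * y + w) / (2 * (a * y))) (t := (a * y - w) / (2 * (a * y)))
    (div_nonneg (by linarith) (by positivity)) (div_nonneg (by linarith) (by positivity))
    (by field_simp; ring) (by rw [hsq]; field_simp; ring)
  rw [Real.cosh_add, Real.cosh_sub] at hconv
  have hcs : Real.sinh a ≤ Real.cosh a := (Real.sinh_lt_cosh a).le
  have hs0 : 0 ≤ Real.sinh a := Real.sinh_nonneg_iff.2 ha.le
  have hu1 : w / (a * y) ≤ 1 := (div_le_one (by positivity)).2 hw.2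
  have key : Real.sinh a * (w / (a * y)) * (Real.sinh y - y) ≤ Real.cosh a * (Real.sinh y - y) := by
    gcongr
    · nlinarith
  refine hconv.trans ?_
  have e1 : (a * y + w) / (2 * (a * y)) * (Real.cosh a * Real.cosh y + Real.sinh a * Real.sinh y) +
      (a * y - w) / (2 * (a * y)) * (Real.cosh a * Real.cosh y - Real.sinh a * Real.sinh y)
      = Real.cosh a * Real.cosh y + Real.sinh a * (w / (a * y)) * Real.sinh y := by
    field_simp; ring
  have e2 : Real.sinh a / a * w = Real.sinh a * (w / (a * y)) * y := by field_simp
  rw [e1, e2, hexp]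
  linarith

variable [SecondCountableTopology H] [MeasurableSpace H] [BorelSpace H]
  {E : Type*} [MeasurableSpace E] (P : Measure E) [IsProbabilityMeasure P]

theorem integral_cosh_norm_add_le [CompleteSpace H] {ξ : E → H} (hξ : Measurable ξ) {B : ℝ}
    (hB : B < 3) (hbound : ∀ x, ‖ξ x‖ ≤ B) (hmean : ∫ x, ξ x ∂P = 0) (s : H) :
    ∫ x, Real.cosh ‖s + ξ x‖ ∂P ≤
      Real.cosh ‖s‖ * (1 + (∫ x, ‖ξ x‖ ^ 2 ∂P) / (2 * (1 - B / 3))) := by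
  obtain ⟨c, hc⟩ := exists_cosh_norm_add_le s
  have hint : Integrable ξ P := .of_bound hξ.aestronglyMeasurable B (ae_of_all _ hbound)
  have hsq : Integrable (fun x => ‖ξ x‖ ^ 2) P :=
    .of_bound (by fun_prop) (B ^ 2) (ae_of_all _ fun x => by
      rw [Real.norm_of_nonneg (by positivity)]
      exact pow_le_pow_left₀ (norm_nonneg _) (hbound x) 2)
  have hin : Integrable (fun x => ⟪c, ξ x⟫) P := hint.const_inner c
  have hmain : Integrable (fun x => Real.cosh ‖s‖ * (1 + ‖ξ x‖ ^ 2 / (2 * (1 - B / 3)))) P :=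
    ((integrable_const _).add (hsq.div_const _)).const_mul _
  calc ∫ x, Real.cosh ‖s + ξ x‖ ∂P
      ≤ ∫ x, (Real.cosh ‖s‖ * (1 + ‖ξ x‖ ^ 2 / (2 * (1 - B / 3))) + ⟪c, ξ x⟫) ∂P := by
        refine integral_mono_of_nonneg (ae_of_all _ fun x => (Real.cosh_pos _).le)
          (hmain.add hin) (ae_of_all _ fun x => (hc _).trans ?_)
        exact add_le_add_left (mul_le_mul_of_nonneg_left
          (exp_sub_id_le_of_lt_three (norm_nonneg _) (hbound x) hB) (Real.cosh_pos _).le) _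
    _ = _ := by
        rw [integral_add hmain hin, integral_const_mul,
          integral_add (integrable_const _) (hsq.div_const _), integral_inner hint, hmean,
          integral_div]
        simp

theorem integral_cosh_norm_sum_le [CompleteSpace H] {ξ : E → H} (hξ : Measurable ξ) {B : ℝ}
    (hB : B < 3) (hbound : ∀ x, ‖ξ x‖ ≤ B) (hmean : ∫ x, ξ x ∂P = 0) (n : ℕ) (s : H) :
    ∫ ω : Fin n → E, Real.cosh ‖s + ∑ i, ξ (ω i)‖ ∂(Measure.pi fun _ => P) ≤
      Real.cosh ‖s‖ * (1 + (∫ x, ‖ξ x‖ ^ 2 ∂P) / (2 * (1 - B / 3))) ^ n := by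
  induction n generalizing s with
  | zero => simp
  | succ n ih =>
    set K := 1 + (∫ x, ‖ξ x‖ ^ 2 ∂P) / (2 * (1 - B / 3))
    have hK : 0 ≤ K := by
      have : 0 ≤ ∫ x, ‖ξ x‖ ^ 2 ∂P := integral_nonneg fun x => by positivity
      have : 0 < 2 * (1 - B / 3) := by linarith
      positivity
    have hmp := (measurePreserving_piFinSuccAbove (fun _ : Fin (n + 1) => P) 0).symm
    let e := (MeasurableEquiv.piFinSuccAbove (fun _ : Fin (n + 1) => E) 0).symm
    have hcomp : ∀ z : E × (Fin n → E),
        Real.cosh ‖s + ∑ i, ξ (e z i)‖ = Real.cosh ‖(s + ξ z.1) + ∑ i, ξ (z.2 i)‖ := by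
      intro z
      rw [Fin.sum_univ_succ, ← add_assoc]
      simp [e, MeasurableEquiv.piFinSuccAbove_symm_apply]
    have hint : Integrable (fun z : E × (Fin n → E) =>
        Real.cosh ‖(s + ξ z.1) + ∑ i, ξ (z.2 i)‖) (P.prod (Measure.pi fun _ => P)) := by
      simp_rw [← hcomp]
      exact (hmp.integrable_comp_emb e.measurableEmbedding).2
        (integrable_cosh_norm_add_sum P hξ hbound (n + 1) s)
    have heq : ∫ ω : Fin (n + 1) → E, Real.cosh ‖s + ∑ i, ξ (ω i)‖ ∂(Measure.pi fun _ => P) =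
        ∫ x, ∫ ω : Fin n → E, Real.cosh ‖(s + ξ x) + ∑ i, ξ (ω i)‖ ∂(Measure.pi fun _ => P) ∂P := by
      rw [← integral_prod _ hint]
      simp_rw [← hcomp]
      exact (hmp.integral_comp e.measurableEmbedding
        (fun ω : Fin (n + 1) → E => Real.cosh ‖s + ∑ i, ξ (ω i)‖)).symm
    rw [heq]
    calc _ ≤ ∫ x, Real.cosh ‖s + ξ x‖ * K ^ n ∂P := by
          refine integral_mono_of_nonneg
            (ae_of_all _ fun x => integral_nonneg fun _ => (Real.cosh_pos _).le) ?_
            (ae_of_all _ fun x => ih _)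
          refine Integrable.mul_const ?_ _
          refine .of_bound (Measurable.aestronglyMeasurable
            (Real.continuous_cosh.measurable.comp (measurable_const.add hξ).norm))
            (Real.cosh (‖s‖ + B)) (ae_of_all _ fun x => ?_)
          rw [Real.norm_of_nonneg (Real.cosh_pos _).le, Real.cosh_le_cosh, abs_norm]
          exact ((norm_add_le _ _).trans (by gcongr; exact hbound x)).trans (le_abs_self _)
      _ ≤ Real.cosh ‖s‖ * K * K ^ n := by
          rw [integral_mul_const]
          gcongr
          exact integral_cosh_norm_add_le P hξ hB hbound hmean s
      _ = _ := by ring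

/-- Exponential bound of Pinelis for the norm of a sum of i.i.d. centred Hilbert-valued variables,
with the sharp normalisation `cosh` kept. -/
theorem measure_norm_sum_ge_le [CompleteSpace H] {ξ : E → H} (hξ : Measurable ξ) {b : ℝ}
    (hbound : ∀ x, ‖ξ x‖ ≤ b) (hmean : ∫ x, ξ x ∂P = 0) {l : ℝ} (hl : 0 ≤ l) (hlb : l * b < 3)
    (n : ℕ) {r : ℝ} (hr : 0 ≤ r) :
    (Measure.pi fun _ : Fin n => P).real {ω | r ≤ ‖∑ i, ξ (ω i)‖} ≤
      Real.exp (n * (l ^ 2 * (∫ x, ‖ξ x‖ ^ 2 ∂P) / (2 * (1 - l * b / 3)))) / Real.cosh (l * r) := by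
  have hb' : ∀ x, ‖l • ξ x‖ ≤ l * b := fun x => by
    rw [norm_smul, Real.norm_of_nonneg hl]; gcongr; exact hbound x
  have hI := integral_cosh_norm_sum_le P (hξ.const_smul l) hlb hb'
    (by simp only [Pi.smul_apply, integral_smul, hmean, smul_zero]) n 0
  have hint := integrable_cosh_norm_add_sum P (hξ.const_smul l) hb' n 0
  have hmk := mul_meas_ge_le_integral_of_nonneg
    (ae_of_all _ fun ω => (Real.cosh_pos _).le) hint (Real.cosh (l * r))
  rw [le_div_iff₀' (Real.cosh_pos _)]
  refine le_trans (mul_le_mul_of_nonneg_left (measureReal_mono fun ω hω => ?_)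
    (Real.cosh_pos _).le) (hmk.trans (hI.trans ?_))
  · simp only [Set.mem_ofPred_eq, zero_add, Pi.smul_apply, ← Finset.smul_sum] at hω ⊢
    rw [Real.cosh_le_cosh, abs_norm, norm_smul, Real.norm_of_nonneg hl,
      abs_of_nonneg (by positivity)]
    gcongr
  · simp only [norm_zero, Real.cosh_zero, one_mul, Pi.smul_apply, norm_smul, mul_pow,
      integral_const_mul, Real.norm_eq_abs, sq_abs]
    rw [Real.exp_nat_mul]
    have : 0 ≤ ∫ x, ‖ξ x‖ ^ 2 ∂P := integral_nonneg fun x => by positivity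
    have : 0 < 2 * (1 - l * b / 3) := by linarith
    refine pow_le_pow_left₀ (by positivity) ?_ _
    linarith [Real.add_one_le_exp (l ^ 2 * (∫ x, ‖ξ x‖ ^ 2 ∂P) / (2 * (1 - l * b / 3)))]

end Pinelis

section UStatistic

open ProbabilityTheory

/-- Averaging over all permutations turns any pair of distinct positions into the
off-diagonal mean. -/
theorem sum_perm_apply_pair {n : ℕ} (f : Fin n → Fin n → ℝ) {a b : Fin n} (hab : a ≠ b) :
    (n * (n - 1) : ℝ) * ∑ σ : Equiv.Perm (Fin n), f (σ a) (σ b) =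
      (n.factorial : ℝ) * ∑ p ∈ Finset.univ.offDiag, f p.1 p.2 := by
  have hconst : ∀ p ∈ (Finset.univ : Finset (Fin n)).offDiag,
      ∑ σ : Equiv.Perm (Fin n), f (σ p.1) (σ p.2) = ∑ σ : Equiv.Perm (Fin n), f (σ a) (σ b) := by
    intro p hp
    obtain ⟨τ, h1, h2⟩ := MulAction.is_two_pretransitive_iff.1
      (Equiv.Perm.isMultiplyPretransitive (Fin n) 2) hab (Finset.mem_offDiag.1 hp).2.2
    simp only [Equiv.Perm.smul_def] at h1 h2
    rw [← h1, ← h2]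
    exact Equiv.sum_comp (Equiv.mulRight τ) fun σ : Equiv.Perm (Fin n) => f (σ a) (σ b)
  have hcard : (((Finset.univ : Finset (Fin n)).offDiag.card : ℕ) : ℝ) = n * (n - 1) := by
    have hle : n ≤ n * n := Nat.le_mul_self n
    rw [Finset.offDiag_card, Finset.card_univ, Fintype.card_fin, Nat.cast_sub hle]
    push_cast; ring
  rw [← hcard, ← nsmul_eq_mul, ← Finset.sum_const, ← Finset.sum_congr rfl hconst, Finset.sum_comm]
  have hinv : ∀ σ : Equiv.Perm (Fin n), ∑ p ∈ (Finset.univ : Finset (Fin n)).offDiag,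
      f (σ p.1) (σ p.2) = ∑ p ∈ (Finset.univ : Finset (Fin n)).offDiag, f p.1 p.2 := by
    intro σ
    refine Finset.sum_equiv (Equiv.prodCongr σ σ) (fun p => ?_) (fun p _ => rfl)
    simp
  rw [Finset.sum_congr rfl fun σ _ => hinv σ, Finset.sum_const, Finset.card_univ,
    Fintype.card_perm, Fintype.card_fin, nsmul_eq_mul]

variable {E : Type*} [MeasurableSpace E] (P : Measure E) [IsProbabilityMeasure P]

theorem map_pi_eval_pair {ι : Type*} [Fintype ι] {a b : ι} (hab : a ≠ b) :
    (Measure.pi fun _ : ι => P).map (fun ω => (ω a, ω b)) = P.prod P := by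
  have hind : iIndepFun (fun (i : ι) (ω : ι → E) => ω i) (Measure.pi fun _ : ι => P) :=
    iIndepFun_pi (X := fun _ => id) fun _ => aemeasurable_id
  rw [(hind.indepFun hab).map_prod_eq_prod_map_map (measurable_pi_apply a).aemeasurable
    (measurable_pi_apply b).aemeasurable]
  congr 1
  · exact (measurePreserving_eval (fun _ : ι => P) a).map_eq
  · exact (measurePreserving_eval (fun _ : ι => P) b).map_eq

theorem integral_prod_pairs {ι κ : Type*} [Fintype ι] [DecidableEq ι] [DecidableEq κ]
    {a b : κ → ι} (ha : a.Injective) (hb : b.Injective) (hab : ∀ i j, a i ≠ b j)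
    {F : E × E → ℝ} (hF : Measurable F) (s : Finset κ) :
    ∫ ω : ι → E, ∏ i ∈ s, F (ω (a i), ω (b i)) ∂(Measure.pi fun _ => P) =
      (∫ z, F z ∂(P.prod P)) ^ s.card := by
  have hind : iIndepFun (fun (i : ι) (ω : ι → E) => ω i) (Measure.pi fun _ : ι => P) :=
    iIndepFun_pi (X := fun _ => id) fun _ => aemeasurable_id
  induction s using Finset.induction_on with
  | empty => simp
  | insert j s hj ih =>
    have hdisj : Disjoint ({a j, b j} : Finset ι) (s.image a ∪ s.image b) := by
      rw [Finset.disjoint_left]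
      intro x hx hx'
      simp only [Finset.mem_insert, Finset.mem_singleton, Finset.mem_union,
        Finset.mem_image] at hx hx'
      rcases hx with rfl | rfl <;> rcases hx' with ⟨i, hi, h⟩ | ⟨i, hi, h⟩
      · exact hj (ha h ▸ hi)
      · exact hab _ _ h.symm
      · exact hab _ _ h
      · exact hj (hb h ▸ hi)
    have h1 : Measurable (fun x : ({a j, b j} : Finset ι) → E =>
        F (x ⟨a j, by simp⟩, x ⟨b j, by simp⟩)) := by fun_prop
    have h2 : Measurable (fun x : (s.image a ∪ s.image b : Finset ι) → E =>
        ∏ i : s, F (x ⟨a i, Finset.mem_union_left _ (Finset.mem_image_of_mem a i.2)⟩,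
          x ⟨b i, Finset.mem_union_right _ (Finset.mem_image_of_mem b i.2)⟩)) := by
      fun_prop
    have hI := (hind.indepFun_finset _ _ hdisj fun i => measurable_pi_apply i).comp h1 h2
    have hmul := hI.integral_fun_mul_eq_mul_integral
      (h1.comp (by fun_prop)).aestronglyMeasurable (h2.comp (by fun_prop)).aestronglyMeasurable
    simp only [Function.comp_def] at hmul
    have hprod : ∀ ω : ι → E, ∏ i : s, F (ω (a i), ω (b i)) = ∏ i ∈ s, F (ω (a i), ω (b i)) :=
      fun ω => Finset.prod_coe_sort s fun i => F (ω (a i), ω (b i))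
    simp only [hprod, ih] at hmul
    simp only [Finset.prod_insert hj, Finset.card_insert_of_notMem hj]
    rw [hmul, pow_succ', ← map_pi_eval_pair P (hab j j),
      integral_map (by fun_prop) hF.aestronglyMeasurable]

theorem exp_neg_mul_le_of_mem_Icc {y : ℝ} (hy : y ∈ Set.Icc (0 : ℝ) 1) (θ : ℝ) :
    Real.exp (-(θ * y)) ≤ 1 - y * (1 - Real.exp (-θ)) := by
  have h := convexOn_exp.2 (Set.mem_univ 0) (Set.mem_univ (-θ)) (sub_nonneg.2 hy.2) hy.1
    (sub_add_cancel 1 y)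
  simp only [smul_eq_mul, mul_zero, zero_add, Real.exp_zero, mul_one] at h
  rw [show -(θ * y) = y * -θ by ring]
  linarith

theorem integral_exp_neg_mul_le {Ω : Type*} [MeasurableSpace Ω] (Q : Measure Ω)
    [IsProbabilityMeasure Q] {h : Ω → ℝ} (hh : Measurable h)
    (h01 : ∀ z, h z ∈ Set.Icc (0 : ℝ) 1) (θ : ℝ) :
    ∫ z, Real.exp (-(θ * h z)) ∂Q ≤ Real.exp (-((∫ z, h z ∂Q) * (1 - Real.exp (-θ)))) := by
  have hint : Integrable h Q := .of_bound hh.aestronglyMeasurable 1 (ae_of_all _ fun z => by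
    rw [Real.norm_of_nonneg (h01 z).1]; exact (h01 z).2)
  calc ∫ z, Real.exp (-(θ * h z)) ∂Q ≤ ∫ z, (1 - h z * (1 - Real.exp (-θ))) ∂Q :=
        integral_mono_of_nonneg (ae_of_all _ fun z => (Real.exp_pos _).le)
          ((integrable_const _).sub (hint.mul_const _))
          (ae_of_all _ fun z => exp_neg_mul_le_of_mem_Icc (h01 z) θ)
    _ = 1 - (∫ z, h z ∂Q) * (1 - Real.exp (-θ)) := by
        rw [integral_sub (integrable_const _) (hint.mul_const _), integral_mul_const]; simp
    _ ≤ _ := Real.one_sub_le_exp_neg _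

/-- Lower tail of a U-statistic of order two with kernel in `[0, 1]`, by Hoeffding's averaging
over disjoint pairs. -/
theorem measure_ustatistic_le {n : ℕ} (hn : 2 ≤ n) {h : E × E → ℝ} (hh : Measurable h)
    (h01 : ∀ z, h z ∈ Set.Icc (0 : ℝ) 1) {θ : ℝ} (hθ : 0 ≤ θ) (w : ℝ) :
    (Measure.pi fun _ : Fin n => P).real
      {ω | 1 / ((n : ℝ) * (n - 1)) * ∑ p ∈ Finset.univ.offDiag, h (ω p.1, ω p.2) ≤ w} ≤
      Real.exp ((n / 2 : ℕ) * (θ * w - (∫ z, h z ∂(P.prod P)) * (1 - Real.exp (-θ)))) := by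
  set m := n / 2 with hm
  set μ := Measure.pi fun _ : Fin n => P
  set U : (Fin n → E) → ℝ := fun ω =>
    1 / ((n : ℝ) * (n - 1)) * ∑ p ∈ Finset.univ.offDiag, h (ω p.1, ω p.2) with hU
  let a : Fin m → Fin n := fun i => ⟨2 * i, by omega⟩
  let b : Fin m → Fin n := fun i => ⟨2 * i + 1, by omega⟩
  have ha : a.Injective := fun i j hij => by simp [a] at hij; omega
  have hb : b.Injective := fun i j hij => by simp [b] at hij; omega
  have hab : ∀ i j, a i ≠ b j := fun i j hij => by simp [a, b] at hij; omega
  have hn1 : (0 : ℝ) < n - 1 := by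
    have : (2 : ℝ) ≤ n := by exact_mod_cast hn
    linarith
  have hn0 : (0 : ℝ) < n := by linarith
  have hfac : (0 : ℝ) < n.factorial := by exact_mod_cast n.factorial_pos
  have hUavg : ∀ ω, m * U ω = ∑ σ : Equiv.Perm (Fin n),
      (n.factorial : ℝ)⁻¹ * ∑ i, h (ω (σ (a i)), ω (σ (b i))) := by
    intro ω
    rw [← Finset.mul_sum, Finset.sum_comm]
    have : ∀ i : Fin m, ∑ σ : Equiv.Perm (Fin n), h (ω (σ (a i)), ω (σ (b i))) =
        n.factorial * U ω := fun i => by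
      have := sum_perm_apply_pair (fun x y => h (ω x, ω y)) (hab i i)
      rw [hU]
      field_simp
      linarith
    rw [Finset.sum_congr rfl fun i _ => this i]
    simp
    field_simp
  have hpt : ∀ ω, Real.exp (-(θ * m) * U ω) ≤ ∑ σ : Equiv.Perm (Fin n),
      (n.factorial : ℝ)⁻¹ * ∏ i, Real.exp (-(θ * h (ω (σ (a i)), ω (σ (b i))))) := by
    intro ω
    have hJ := convexOn_exp.map_sum_le (t := (Finset.univ : Finset (Equiv.Perm (Fin n))))
      (w := fun _ => (n.factorial : ℝ)⁻¹)
      (p := fun σ => -(θ * ∑ i, h (ω (σ (a i)), ω (σ (b i)))))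
      (fun _ _ => by positivity)
      (by simp [Finset.card_univ, Fintype.card_perm, hfac.ne']) (fun _ _ => Set.mem_univ _)
    simp only [smul_eq_mul] at hJ
    convert! hJ using 1
    · rw [neg_mul, mul_assoc, hUavg, Finset.mul_sum, ← Finset.sum_neg_distrib]
      exact congrArg Real.exp (Finset.sum_congr rfl fun σ _ => by ring)
    · refine Finset.sum_congr rfl fun σ _ => ?_
      rw [← Real.exp_sum, Finset.sum_neg_distrib, Finset.mul_sum]
  have hUm : Measurable U := by fun_prop
  have hU0 : ∀ ω, 0 ≤ U ω := fun ω =>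
    mul_nonneg (by positivity) (Finset.sum_nonneg fun p _ => (h01 _).1)
  have hexpint : ∀ {f : (Fin n → E) → ℝ}, Measurable f → (∀ ω, 0 ≤ f ω) →
      Integrable (fun ω => Real.exp (-(f ω))) μ := fun hf hf0 =>
    .of_bound (by fun_prop) 1 (ae_of_all _ fun ω => by
      rw [Real.norm_of_nonneg (Real.exp_pos _).le, Real.exp_le_one_iff]
      linarith [hf0 ω])
  have hUint : Integrable (fun ω => Real.exp (-(θ * m) * U ω)) μ := by
    simp_rw [neg_mul]
    exact hexpint (by fun_prop) fun ω => mul_nonneg (by positivity) (hU0 ω)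
  have hprodint : ∀ σ : Equiv.Perm (Fin n),
      Integrable (fun ω => ∏ i, Real.exp (-(θ * h (ω (σ (a i)), ω (σ (b i)))))) μ := fun σ => by
    simp_rw [← Real.exp_sum, Finset.sum_neg_distrib]
    exact hexpint (by fun_prop) fun ω =>
      Finset.sum_nonneg fun i _ => mul_nonneg hθ (h01 _).1
  have hmgf : mgf U μ (-(θ * m)) ≤ Real.exp (-((∫ z, h z ∂(P.prod P)) * (1 - Real.exp (-θ)))) ^ m :=
    calc mgf U μ (-(θ * m)) ≤ ∫ ω, ∑ σ : Equiv.Perm (Fin n),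
          (n.factorial : ℝ)⁻¹ * ∏ i, Real.exp (-(θ * h (ω (σ (a i)), ω (σ (b i))))) ∂μ :=
          integral_mono hUint (integrable_finsetSum _ fun σ _ => (hprodint σ).const_mul _) hpt
      _ = ∑ σ : Equiv.Perm (Fin n), (n.factorial : ℝ)⁻¹ *
            (∫ z, Real.exp (-(θ * h z)) ∂(P.prod P)) ^ m := by
          rw [integral_finsetSum _ fun σ _ => (hprodint σ).const_mul _]
          refine Finset.sum_congr rfl fun σ _ => ?_
          rw [integral_const_mul, integral_prod_pairs P (F := fun z => Real.exp (-(θ * h z)))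
            (a := fun i => σ (a i)) (b := fun i => σ (b i)) (σ.injective.comp ha)
            (σ.injective.comp hb) (fun i j => σ.injective.ne (hab i j)) (by fun_prop)]
          simp
      _ = (∫ z, Real.exp (-(θ * h z)) ∂(P.prod P)) ^ m := by
          simp [Finset.card_univ, Fintype.card_perm, hfac.ne']
      _ ≤ _ := pow_le_pow_left₀ (integral_nonneg fun z => (Real.exp_pos _).le)
          (integral_exp_neg_mul_le _ hh h01 θ) _
  have hmain := measure_le_le_exp_mul_mgf (μ := μ) (X := U) (t := -(θ * m)) w
    (by have : 0 ≤ θ * m := by positivity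
        linarith) hUint
  refine hmain.trans ((mul_le_mul_of_nonneg_left hmgf (Real.exp_pos _).le).trans_eq ?_)
  rw [← Real.exp_nat_mul, ← Real.exp_add]
  congr 1
  ring

end UStatistic

section Numerics

theorem neg_two_mul_log_le {y : ℝ} (hy : 0 < y) (hy1 : y ≤ 1) :
    -(2 * Real.log y) ≤ y⁻¹ - y := by
  have h := Real.self_le_sinh_iff.2 (Real.log_nonneg ((one_le_inv₀ hy).2 hy1))
  rw [Real.sinh_log (inv_pos.2 hy), inv_inv, Real.log_inv] at h
  linarith

/-- The slack between `1 / cosh` and `2 exp (-·)` absorbs a term of order `exp (-5 L)`. -/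
theorem exp_div_cosh_add_exp_le {L : ℝ} (hL : Real.log 2 ≤ L) :
    Real.exp L / Real.cosh (2 * L) + Real.exp (-(5 * L) + 1 / 2) ≤ 2 * Real.exp (-L) := by
  set u := Real.exp (-L) with hu
  have hu0 : 0 < u := Real.exp_pos _
  have hu2 : u ≤ 1 / 2 := by
    rw [hu, Real.exp_neg, one_div]
    exact inv_anti₀ two_pos ((Real.log_le_iff_le_exp two_pos).1 hL)
  have hL' : Real.exp L = u⁻¹ := by rw [hu, Real.exp_neg, inv_inv]
  have h2 : Real.exp (2 * L) = (u ^ 2)⁻¹ := by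
    rw [← inv_pow, ← hL', ← Real.exp_nat_mul]; norm_num
  have h2' : Real.exp (-(2 * L)) = u ^ 2 := by rw [Real.exp_neg, h2, inv_inv]
  have h5 : Real.exp (-(5 * L)) = u ^ 5 := by
    rw [hu, ← Real.exp_nat_mul]; congr 1; push_cast; ring
  have hhalf : Real.exp (1 / 2) ≤ 1.65 := by
    refine abs_le_of_sq_le_sq' ?_ (by norm_num) |>.2
    rw [← Real.exp_nat_mul]
    norm_num
    linarith [Real.exp_one_lt_d9]
  have hu4 : u ^ 4 ≤ 1 / 16 := by
    calc u ^ 4 ≤ (1 / 2) ^ 4 := pow_le_pow_left₀ hu0.le hu2 4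
      _ = 1 / 16 := by norm_num
  rw [Real.exp_add, h5, Real.cosh_eq, h2, h2', hL']
  have e1 : u⁻¹ / (((u ^ 2)⁻¹ + u ^ 2) / 2) = 2 * u / (1 + u ^ 4) := by field_simp
  have e2 : 2 * u - 2 * u / (1 + u ^ 4) = u ^ 5 * (2 / (1 + u ^ 4)) := by field_simp; ring
  have e3 : (1.65 : ℝ) ≤ 2 / (1 + u ^ 4) := by
    rw [le_div_iff₀ (by positivity)]; linarith
  have e4 : u ^ 5 * Real.exp (1 / 2) ≤ u ^ 5 * (2 / (1 + u ^ 4)) := by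
    gcongr; exact hhalf.trans e3
  rw [e1]
  linarith

end Numerics

section Bernstein

variable {H : Type*} [NormedAddCommGroup H] [InnerProductSpace ℝ H]
  [CompleteSpace H] [SecondCountableTopology H] [MeasurableSpace H] [BorelSpace H]
  {E : Type*} [MeasurableSpace E] (P : Measure E) [IsProbabilityMeasure P]

/-- When the variance is small compared to `d ^ 2 * L / n`, the norm of the sum is bounded by its
second-order term alone. -/
theorem measure_norm_sum_ge_le_of_small_variance {ξ : E → H} (hξ : Measurable ξ) {d : ℝ}
    (hd : 0 < d) (hbound : ∀ x, ‖ξ x‖ ≤ √2 * d) (hmean : ∫ x, ξ x ∂P = 0) {n : ℕ} {L : ℝ}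
    (hL : 0 ≤ L) (hv : n * ∫ x, ‖ξ x‖ ^ 2 ∂P ≤ 45 / 4 * d ^ 2 * L) :
    (Measure.pi fun _ : Fin n => P).real {ω | 16 / 3 * d * L ≤ ‖∑ i, ξ (ω i)‖} ≤
      2 * Real.exp (-L) := by
  have hs0 : 0 < √2 := by positivity
  have hs2 : √2 ^ 2 = 2 := Real.sq_sqrt (by norm_num)
  have hs : √2 ≤ 1.4143 := Real.sqrt_le_iff.2 ⟨by norm_num, by norm_num⟩
  set v := ∫ x, ‖ξ x‖ ^ 2 ∂P
  set l := 1 / (2 * (√2 * d)) with hl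
  have hlb : l * (√2 * d) = 1 / 2 := by rw [hl]; field_simp
  have hr : 0 ≤ 16 / 3 * d * L := by positivity
  refine (measure_norm_sum_ge_le P hξ hbound hmean (l := l) (by positivity)
    (by rw [hlb]; norm_num) n hr).trans ?_
  rw [hlb, div_le_iff₀ (Real.cosh_pos _)]
  have hl2 : l ^ 2 = 1 / (8 * d ^ 2) := by
    rw [hl, div_pow, mul_pow, mul_pow, hs2]; norm_num; ring
  have hA : n * (l ^ 2 * v / (2 * (1 - 1 / 2 / 3))) ≤ 27 / 32 * L := by
    have : n * (l ^ 2 * v / (2 * (1 - 1 / 2 / 3))) = (n * v) * (3 / (40 * d ^ 2)) := by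
      rw [hl2]; field_simp; ring
    rw [this]
    calc (n * v) * (3 / (40 * d ^ 2)) ≤ (45 / 4 * d ^ 2 * L) * (3 / (40 * d ^ 2)) := by gcongr
      _ = 27 / 32 * L := by field_simp; ring
  have hlr : 1.885 * L ≤ l * (16 / 3 * d * L) := by
    have : l * (16 / 3 * d * L) = 8 / (3 * √2) * L := by rw [hl]; field_simp; ring
    rw [this]
    gcongr
    rw [le_div_iff₀ (by positivity)]
    linarith
  have hcosh : Real.exp (l * (16 / 3 * d * L)) ≤ 2 * Real.cosh (l * (16 / 3 * d * L)) := by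
    rw [Real.cosh_eq]; linarith [Real.exp_pos (-(l * (16 / 3 * d * L)))]
  calc _ ≤ Real.exp (-L + l * (16 / 3 * d * L)) := Real.exp_le_exp.2 (by linarith)
    _ = Real.exp (-L) * Real.exp (l * (16 / 3 * d * L)) := Real.exp_add _ _
    _ ≤ Real.exp (-L) * (2 * Real.cosh (l * (16 / 3 * d * L))) := by gcongr
    _ = _ := by ring

/-- Bernstein's inequality for Hilbert-valued variables, with `2 exp (-L)` sharpened to
`exp L / cosh (2 L)` and `L = n * x ^ 2`. -/
theorem measure_norm_sum_ge_le_exp_div_cosh {ξ : E → H} (hξ : Measurable ξ) {b s x : ℝ}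
    (hb : 0 < b) (hs : 0 < s) (hx : 0 < x) (hbound : ∀ x, ‖ξ x‖ ≤ b) (hmean : ∫ x, ξ x ∂P = 0)
    (hv : ∫ x, ‖ξ x‖ ^ 2 ∂P = s ^ 2) (n : ℕ) :
    (Measure.pi fun _ : Fin n => P).real
      {ω | n * (√2 * x * s + 2 / 3 * b * x ^ 2) ≤ ‖∑ i, ξ (ω i)‖} ≤
      Real.exp (n * x ^ 2) / Real.cosh (2 * (n * x ^ 2)) := by
  set a := b * x ^ 2 / 3 with ha
  have ha0 : 0 < a := by positivity
  set q := √(a ^ 2 + (√2 * x * s) ^ 2) with hq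
  have hq2 : q ^ 2 = a ^ 2 + 2 * x ^ 2 * s ^ 2 := by
    rw [hq, Real.sq_sqrt (by positivity), mul_pow, mul_pow, Real.sq_sqrt (by norm_num)]
  have hqle : q ≤ a + √2 * x * s := by
    rw [hq, Real.sqrt_le_left (by positivity)]
    have : 0 ≤ a * (√2 * x * s) := by positivity
    nlinarith
  set t := a + q with ht
  have ht0 : 0 < t := by positivity
  have ht2 : t ^ 2 = 2 * x ^ 2 * (s ^ 2 + b * t / 3) := by
    have : t ^ 2 = 2 * a * t + 2 * x ^ 2 * s ^ 2 := by rw [ht]; nlinarith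
    rw [this, ha]; ring
  set w := s ^ 2 + b * t / 3 with hw
  have hw0 : 0 < w := by positivity
  have h1 : 1 - t / w * b / 3 = s ^ 2 / w := by rw [eq_div_iff hw0.ne', hw]; field_simp; ring
  have h1' : 0 < s ^ 2 / w := by positivity
  have hmain := measure_norm_sum_ge_le P hξ hbound hmean (l := t / w) (by positivity)
    (by linarith) n (r := n * t) (by positivity)
  rw [h1, hv] at hmain
  have e1 : (n : ℝ) * ((t / w) ^ 2 * s ^ 2 / (2 * (s ^ 2 / w))) = n * x ^ 2 := by
    rw [div_pow, ht2]; field_simp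
  have e2 : t / w * (n * t) = 2 * (n * x ^ 2) := by
    have : t / w * (n * t) = n * t ^ 2 / w := by ring
    rw [this, ht2]; field_simp
  rw [e1, e2] at hmain
  have htle : n * t ≤ n * (√2 * x * s + 2 / 3 * b * x ^ 2) := by
    gcongr
    rw [ht]; linarith
  have hsub : {ω : Fin n → E | n * (√2 * x * s + 2 / 3 * b * x ^ 2) ≤ ‖∑ i, ξ (ω i)‖} ⊆
      {ω | n * t ≤ ‖∑ i, ξ (ω i)‖} := Set.ofPred_subset_ofPred.2 fun _ => htle.trans
  exact (measureReal_mono hsub).trans hmain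

/-- Lower deviations of a U-statistic with mean `s ^ 2 / d ^ 2`, on the scale relevant for the
square root of the empirical variance. -/
theorem measure_ustatistic_le_exp {n : ℕ} (hn : 2 ≤ n) {h : E × E → ℝ} (hh : Measurable h)
    (h01 : ∀ z, h z ∈ Set.Icc (0 : ℝ) 1) {d s x : ℝ} (hd : 0 < d) (hs : 0 < s) (hx : 0 < x)
    (hsd : s ≤ d) (hxs : 45 / 4 * d ^ 2 * x ^ 2 ≤ s ^ 2)
    (hmean : ∫ z, h z ∂(P.prod P) = s ^ 2 / d ^ 2) :
    (Measure.pi fun _ : Fin n => P).real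
      {ω | 1 / ((n : ℝ) * (n - 1)) * ∑ p ∈ Finset.univ.offDiag, h (ω p.1, ω p.2) ≤
        (s - 3.1 * x * d) ^ 2 / d ^ 2} ≤
      Real.exp (-(5 * (n * x ^ 2)) + 1 / 2) := by
  set c := d * x / s with hc
  have hc0 : 0 < c := by positivity
  have hc2 : c ^ 2 ≤ 4 / 45 := by
    rw [hc, div_pow, mul_pow, div_le_iff₀ (by positivity)]; linarith
  have hc1 : c ≤ 0.2982 := abs_le_of_sq_le_sq' (by norm_num at hc2 ⊢; linarith) (by norm_num) |>.2
  set y := 1 - 3.1 * c with hy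
  have hy0 : 0.0755 ≤ y := by rw [hy]; linarith
  have hypos : 0 < y := by linarith
  have hy1 : y ≤ 1 := by rw [hy]; linarith
  have hx2 : x ^ 2 ≤ 4 / 45 := by
    have h1 : 45 / 4 * d ^ 2 * x ^ 2 ≤ d ^ 2 := hxs.trans (pow_le_pow_left₀ hs.le hsd 2)
    have h2 : d ^ 2 * (45 / 4 * x ^ 2) ≤ d ^ 2 * 1 := by linarith
    linarith [le_of_mul_le_mul_left h2 (by positivity)]
  have hθ : 0 ≤ -(2 * Real.log y) := by linarith [Real.log_nonpos hypos.le hy1]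
  have hw : (s - 3.1 * x * d) ^ 2 / d ^ 2 = s ^ 2 / d ^ 2 * y ^ 2 := by
    rw [hy, hc]; field_simp
  rw [hw]
  refine (measure_ustatistic_le P hn hh h01 hθ _).trans (Real.exp_le_exp.2 ?_)
  have hexp : Real.exp (-(-(2 * Real.log y))) = y ^ 2 := by
    rw [neg_neg, two_mul, Real.exp_add, Real.exp_log hypos, sq]
  rw [hmean, hexp]
  have hlog := neg_two_mul_log_le hypos hy1
  have hm : ((n : ℝ) - 1) / 2 ≤ (n / 2 : ℕ) := by
    have : n ≤ 2 * (n / 2) + 1 := by omega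
    have : (n : ℝ) ≤ 2 * (n / 2 : ℕ) + 1 := by exact_mod_cast this
    linarith
  have hn1 : (1 : ℝ) ≤ n - 1 := by
    have : (2 : ℝ) ≤ n := by exact_mod_cast hn
    linarith
  have hκ : s ^ 2 / d ^ 2 * (1 - y) ^ 2 = 9.61 * x ^ 2 := by
    rw [hy, hc]; field_simp; norm_num; ring
  have hinner : -(2 * Real.log y) * (s ^ 2 / d ^ 2 * y ^ 2) - s ^ 2 / d ^ 2 * (1 - y ^ 2) ≤
      -(9.61 * x ^ 2 * 1.0755) := by
    calc _ ≤ (y⁻¹ - y) * (s ^ 2 / d ^ 2 * y ^ 2) - s ^ 2 / d ^ 2 * (1 - y ^ 2) := by gcongr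
      _ = -(s ^ 2 / d ^ 2 * (1 - y) ^ 2 * (1 + y)) := by field_simp; ring
      _ ≤ _ := by rw [hκ]; gcongr; linarith
  calc _ ≤ ((n / 2 : ℕ) : ℝ) * -(9.61 * x ^ 2 * 1.0755) := by gcongr
    _ ≤ ((n : ℝ) - 1) / 2 * -(9.61 * x ^ 2 * 1.0755) := by
        refine mul_le_mul_of_nonpos_right hm ?_
        have : 0 ≤ 9.61 * x ^ 2 * 1.0755 := by positivity
        linarith
    _ ≤ _ := by nlinarith [mul_nonneg (Nat.cast_nonneg (α := ℝ) n) (sq_nonneg x)]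

/-- Empirical Bernstein inequality: the variance in the bound for the norm of the mean is replaced
by a U-statistic with the same expectation. -/
theorem measure_lt_norm_sum_div_le {ξ : E → H} (hξ : Measurable ξ) {d : ℝ} (hd0 : 0 < d)
    (hbound : ∀ x, ‖ξ x‖ ≤ √2 * d) (hmean : ∫ x, ξ x ∂P = 0) {h : E × E → ℝ} (hhm : Measurable h)
    (h01 : ∀ z, h z ∈ Set.Icc (0 : ℝ) 1) {n : ℕ} (hn : 2 ≤ n)
    (hmeanh : ∫ z, h z ∂(P.prod P) = (∫ x, ‖ξ x‖ ^ 2 ∂P) / d ^ 2) {L : ℝ}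
    (hL : Real.log 2 ≤ L) :
    (Measure.pi fun _ : Fin n => P).real
      {ω | √(2 * (d ^ 2 * (1 / ((n : ℝ) * (n - 1)) *
          ∑ p ∈ Finset.univ.offDiag, h (ω p.1, ω p.2))) * L / n) + 16 / 3 * d * L / n <
        ‖∑ t, ξ (ω t)‖ / n} ≤ 2 * Real.exp (-L) := by
  have hL0 : 0 < L := (Real.log_pos one_lt_two).trans_le hL
  have hn0 : (0 : ℝ) < n := by exact_mod_cast (zero_lt_two.trans_le hn)
  set v := ∫ x, ‖ξ x‖ ^ 2 ∂P with hv
  rcases le_or_gt (n * v) (45 / 4 * d ^ 2 * L) with hcase | hcase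
  · refine le_trans (measureReal_mono ?_) (measure_norm_sum_ge_le_of_small_variance P hξ hd0 hbound
      hmean hL0.le hcase)
    intro ω hω
    simp only [Set.mem_ofPred_eq] at hω ⊢
    have h1 := (le_add_of_nonneg_left (Real.sqrt_nonneg _)).trans_lt hω
    exact ((div_lt_div_iff_of_pos_right hn0).1 h1).le
  set x := √(L / n) with hx
  have hx0 : 0 < x := Real.sqrt_pos.2 (by positivity)
  have hx2 : x ^ 2 = L / n := Real.sq_sqrt (by positivity)
  have hnx : n * x ^ 2 = L := by rw [hx2]; field_simp
  have hv0 : 0 < v := by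
    have : 0 < n * v := lt_trans (by positivity) hcase
    exact pos_of_mul_pos_right this hn0.le
  set s := √v with hs
  have hs0 : 0 < s := Real.sqrt_pos.2 hv0
  have hs2 : s ^ 2 = v := Real.sq_sqrt hv0.le
  have hvle : v ≤ d ^ 2 := by
    have : v / d ^ 2 ≤ 1 := by
      rw [← hmeanh]
      have hI : Integrable h (P.prod P) := .of_bound hhm.aestronglyMeasurable 1
        (ae_of_all _ fun z => by rw [Real.norm_of_nonneg (h01 z).1]; exact (h01 z).2)
      simpa using integral_mono hI (integrable_const 1) fun z => (h01 z).2
    exact (div_le_one (by positivity)).1 this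
  have hsd : s ≤ d := abs_le_of_sq_le_sq' (hs2.trans_le hvle) hd0.le |>.2
  have hxs : 45 / 4 * d ^ 2 * x ^ 2 ≤ s ^ 2 := by
    rw [hs2, hx2, ← mul_div_assoc, div_le_iff₀' hn0]; exact hcase.le
  have hA := measure_norm_sum_ge_le_exp_div_cosh P hξ (b := √2 * d) (by positivity) hs0 hx0 hbound
    hmean (hs2.symm) n
  have hB := measure_ustatistic_le_exp P hn hhm h01 hd0 hs0 hx0 hsd hxs (by rw [hmeanh, hs2])
  rw [hnx] at hA hB
  refine le_trans ((measureReal_mono ?_).trans (measureReal_union_le _ _))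
    ((add_le_add hA hB).trans (exp_div_cosh_add_exp_le hL))
  intro ω hω
  by_contra hAB
  simp only [Set.mem_union, Set.mem_ofPred_eq, not_or, not_le] at hω hAB
  obtain ⟨h1, h2⟩ := hAB
  replace h1 := (div_lt_iff₀' hn0).2 h1
  generalize 1 / ((n : ℝ) * (n - 1)) * ∑ p ∈ Finset.univ.offDiag, h (ω p.1, ω p.2) = U at *
  have hr0 : 0 < √2 := by positivity
  have hr2 : √2 ^ 2 = 2 := Real.sq_sqrt (by norm_num)
  have hr : √2 ≤ 1.4143 := Real.sqrt_le_iff.2 ⟨by norm_num, by norm_num⟩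
  have hpos : 0 ≤ s - 3.1 * x * d := by
    refine sub_nonneg.2 (abs_le_of_sq_le_sq' ?_ hs0.le |>.2)
    refine le_trans ?_ hxs
    nlinarith [sq_nonneg (x * d)]
  have hroot : √2 * x * (s - 3.1 * x * d) ≤ √(2 * (d ^ 2 * U) * L / n) := by
    refine Real.le_sqrt_of_sq_le ?_
    rw [div_lt_iff₀' (by positivity)] at h2
    calc (√2 * x * (s - 3.1 * x * d)) ^ 2 = 2 * x ^ 2 * (s - 3.1 * x * d) ^ 2 := by
          rw [mul_pow, mul_pow, hr2]
      _ ≤ 2 * x ^ 2 * (d ^ 2 * U) := by gcongr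
      _ = _ := by rw [hx2]; ring
  have hlast : 16 / 3 * d * L / n = 16 / 3 * d * x ^ 2 := by rw [hx2]; ring
  rw [hlast] at hω
  have hdx : 0 < d * x ^ 2 := by positivity
  nlinarith [mul_le_mul_of_nonneg_left hr hdx.le]

end Bernstein

section Kernel

variable {H : Type*} [NormedAddCommGroup H] [InnerProductSpace ℝ H]
  {E : Type*} [MeasurableSpace E] (P : Measure E) [IsProbabilityMeasure P]

theorem norm_sub_integral_le [CompleteSpace H] {φ : E → H} (hint : Integrable φ P) {b : ℝ}
    (hb : ∀ x y, ‖φ x - φ y‖ ≤ b) (x : E) : ‖φ x - ∫ y, φ y ∂P‖ ≤ b := by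
  have : φ x - ∫ y, φ y ∂P = ∫ y, (φ x - φ y) ∂P := by
    rw [integral_sub (integrable_const _) hint]; simp
  rw [this]
  simpa using norm_integral_le_of_norm_le_const (μ := P) (ae_of_all _ fun y => hb x y)

theorem integral_norm_sub_integral_sq [CompleteSpace H] {φ : E → H} {c : ℝ}
    (hc : ∀ x, ‖φ x‖ ^ 2 = c) (hint : Integrable φ P) :
    ∫ x, ‖φ x - ∫ y, φ y ∂P‖ ^ 2 ∂P = c - ‖∫ y, φ y ∂P‖ ^ 2 := by
  set m := ∫ y, φ y ∂P with hm
  have h1 : ∀ x, ‖φ x - m‖ ^ 2 = (c + ‖m‖ ^ 2) - 2 * ⟪m, φ x⟫ := fun x => by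
    rw [norm_sub_sq_real, hc, real_inner_comm]; ring
  simp_rw [h1]
  rw [integral_sub (integrable_const _) ((hint.const_inner m).const_mul 2), integral_const_mul,
    integral_inner hint, ← hm, real_inner_self_eq_norm_sq]
  simp; ring

theorem integral_prod_inner_eq [CompleteSpace H] [SecondCountableTopology H] [MeasurableSpace H]
    [BorelSpace H] {φ : E → H} (hφ : Measurable φ) {c : ℝ}
    (hc : ∀ x, ‖φ x‖ ^ 2 = c) (hint : Integrable φ P) :
    ∫ z : E × E, ⟪φ z.2, φ z.1⟫ ∂(P.prod P) = ‖∫ y, φ y ∂P‖ ^ 2 := by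
  have hI : Integrable (fun z : E × E => ⟪φ z.2, φ z.1⟫) (P.prod P) := by
    refine .of_bound (Measurable.aestronglyMeasurable (by fun_prop)) c (ae_of_all _ fun z => ?_)
    refine (norm_inner_le_norm _ _).trans ?_
    nlinarith [hc z.1, hc z.2, sq_nonneg (‖φ z.2‖ - ‖φ z.1‖)]
  rw [integral_prod _ hI]
  have : ∀ x, ∫ y, ⟪φ y, φ x⟫ ∂P = ⟪∫ y, φ y ∂P, φ x⟫ := fun x => by
    simp_rw [real_inner_comm (φ x)]
    exact integral_inner hint _
  simp_rw [this]
  rw [integral_inner hint, real_inner_self_eq_norm_sq]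

/-- Empirical Bernstein inequality for the kernel mean embedding of a kernel that is constant on
the diagonal. -/
theorem measure_lt_norm_mean_sub_integral_le [CompleteSpace H] [SecondCountableTopology H]
    [MeasurableSpace H] [BorelSpace H] {φ : E → H} (hφ : Measurable φ) {c Δ : ℝ} (hΔ : 0 < Δ)
    (hc : ∀ x, ‖φ x‖ ^ 2 = c) (hle : ∀ x y, c - ⟪φ x, φ y⟫ ≤ Δ) {n : ℕ} (hn : 2 ≤ n) {L : ℝ}
    (hL : Real.log 2 ≤ L) :
    (Measure.pi fun _ : Fin n => P).real
      {ω | √(2 * (c - 1 / ((n : ℝ) * (n - 1)) *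
          ∑ p ∈ Finset.univ.offDiag, ⟪φ (ω p.2), φ (ω p.1)⟫) * L / n) + 16 / 3 * √Δ * L / n <
        ‖(n : ℝ)⁻¹ • ∑ t, φ (ω t) - ∫ x, φ x ∂P‖} ≤ 2 * Real.exp (-L) := by
  set m := ∫ x, φ x ∂P with hm
  set d := √Δ with hd
  have hd0 : 0 < d := Real.sqrt_pos.2 hΔ
  have hd2 : d ^ 2 = Δ := Real.sq_sqrt hΔ.le
  have hn2 : (2 : ℝ) ≤ n := by exact_mod_cast hn
  have hn0 : (0 : ℝ) < n := by linarith
  have hn1 : (0 : ℝ) < n - 1 := by linarith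
  have hφc : ∀ x, ‖φ x‖ = √c := fun x => by rw [← hc x, Real.sqrt_sq (norm_nonneg _)]
  have hint : Integrable φ P := .of_bound hφ.aestronglyMeasurable √c
    (ae_of_all _ fun x => (hφc x).le)
  set ξ : E → H := fun x => φ x - m with hξ
  have hξm : Measurable ξ := hφ.sub_const m
  have hbound : ∀ x, ‖ξ x‖ ≤ √2 * d := norm_sub_integral_le P hint fun x y => by
    refine abs_le_of_sq_le_sq' ?_ (by positivity) |>.2
    rw [norm_sub_sq_real, hc, hc, mul_pow, Real.sq_sqrt (by norm_num), hd2]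
    linarith [hle x y]
  have hmean : ∫ x, ξ x ∂P = 0 := by
    rw [hξ, integral_sub hint (integrable_const _), ← hm]; simp
  have hvar : ∫ x, ‖ξ x‖ ^ 2 ∂P = c - ‖m‖ ^ 2 := integral_norm_sub_integral_sq P hc hint
  have hsum : ∀ ω : Fin n → E, n * ‖(n : ℝ)⁻¹ • ∑ t, φ (ω t) - m‖ = ‖∑ t, ξ (ω t)‖ := fun ω => by
    have : ∑ t, ξ (ω t) = (n : ℝ) • ((n : ℝ)⁻¹ • ∑ t, φ (ω t) - m) := by
      rw [smul_sub, smul_inv_smul₀ hn0.ne', hξ, Finset.sum_sub_distrib]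
      simp [Nat.cast_smul_eq_nsmul]
    rw [this, norm_smul, Real.norm_of_nonneg hn0.le]
  set h : E × E → ℝ := fun z => (c - ⟪φ z.2, φ z.1⟫) / d ^ 2 with hh
  have hhm : Measurable h := by fun_prop
  have h01 : ∀ z, h z ∈ Set.Icc (0 : ℝ) 1 := fun z => by
    have := real_inner_le_norm (φ z.2) (φ z.1)
    rw [hφc, hφc, ← sq, ← hφc z.1, hc] at this
    exact ⟨div_nonneg (by linarith) (by positivity),
      (div_le_one (by positivity)).2 (by rw [hd2]; exact hle _ _)⟩
  have hhint : ∫ z, h z ∂(P.prod P) = (c - ‖m‖ ^ 2) / d ^ 2 := by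
    have hI : Integrable (fun z : E × E => ⟪φ z.2, φ z.1⟫) (P.prod P) := by
      refine .of_bound (Measurable.aestronglyMeasurable (by fun_prop)) c (ae_of_all _ fun z => ?_)
      refine (norm_inner_le_norm _ _).trans ?_
      rw [hφc, hφc, ← sq, ← hφc z.1, hc]
    rw [hh, integral_div, integral_sub (integrable_const _) hI, integral_prod_inner_eq P hφ hc hint]
    simp [hm]
  have hcard : (((Finset.univ : Finset (Fin n)).offDiag.card : ℕ) : ℝ) = n * (n - 1) := by
    rw [Finset.offDiag_card, Finset.card_univ, Fintype.card_fin, Nat.cast_sub n.le_mul_self]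
    push_cast; ring
  have hU : ∀ ω : Fin n → E, c - 1 / ((n : ℝ) * (n - 1)) *
      ∑ p ∈ Finset.univ.offDiag, ⟪φ (ω p.2), φ (ω p.1)⟫ =
      d ^ 2 * (1 / ((n : ℝ) * (n - 1)) * ∑ p ∈ Finset.univ.offDiag, h (ω p.1, ω p.2)) := fun ω => by
    simp only [hh, ← Finset.sum_div, Finset.sum_sub_distrib, Finset.sum_const, nsmul_eq_mul, hcard]
    field_simp
  have hmain := measure_lt_norm_sum_div_le P hξm hd0 hbound hmean hhm h01 hn
    (by rw [hhint, hvar]) hL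
  simp only [hU]
  simp only [← hsum, mul_div_cancel_left₀ _ hn0.ne'] at hmain
  exact hmain

end Kernel

/-- Empirical-variance high-confidence convergence rate,
translation-invariant kernel. With probability at least `1 − δ`,
`‖μ̂_n − μ_P‖ ≤ √(2 v̂ log(2/δ)/n) + (16/3) √Δψ log(2/δ)/n`. -/
theorem empirical_variance_rate_TI
    (d n : ℕ) (hn : 2 ≤ n)
    (ψ : (Fin d → ℝ) → ℝ)
    (hψ_even : ∀ y, ψ (-y) = ψ y)
    (hψ_sup : ∀ y, ψ y ≤ ψ 0)
    (ψInf : ℝ) (hψInf : IsGLB (Set.range ψ) ψInf)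
    (Δψ : ℝ) (hΔψ : Δψ = ψ 0 - ψInf) (hΔψ_pos : 0 < Δψ)
    {H : Type*} [NormedAddCommGroup H] [InnerProductSpace ℝ H] [CompleteSpace H]
    [SecondCountableTopology H] [MeasurableSpace H] [BorelSpace H]
    (φ : (Fin d → ℝ) → H) (hφ_meas : Measurable φ)
    (hφ_kernel : ∀ x x', ⟪φ x, φ x'⟫ = ψ (x' - x))
    (P : Measure (Fin d → ℝ)) [IsProbabilityMeasure P]
    (μP : H) (hμP : μP = ∫ x, φ x ∂P)
    (vhat : (Fin n → Fin d → ℝ) → ℝ)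
    (hvhat : ∀ x, vhat x = ψ 0 - (1 / ((n : ℝ) * ((n : ℝ) - 1))) *
      ∑ p ∈ Finset.univ.offDiag, ψ (x p.1 - x p.2))
    (δ : ℝ) (hδ : δ ∈ Set.Ioo (0 : ℝ) 1) :
    ENNReal.ofReal (1 - δ) ≤
      (Measure.pi fun _ : Fin n => P)
        {ω | ‖(n : ℝ)⁻¹ • (∑ t, φ (ω t)) - μP‖ ≤
          Real.sqrt (2 * vhat ω * Real.log (2 / δ) / n)
            + (16 / 3) * Real.sqrt Δψ * Real.log (2 / δ) / n} := by
  have hδ0 := hδ.1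
  have hc : ∀ x, ‖φ x‖ ^ 2 = ψ 0 := fun x => by
    rw [← real_inner_self_eq_norm_sq, hφ_kernel, sub_self]
  have hle : ∀ x y, ψ 0 - ⟪φ x, φ y⟫ ≤ Δψ := fun x y => by
    rw [hφ_kernel, hΔψ]
    linarith [hψInf.1 (Set.mem_range_self (y - x))]
  have hL : Real.log 2 ≤ Real.log (2 / δ) :=
    Real.log_le_log two_pos ((le_div_iff₀ hδ0).2 (by linarith [hδ.2]))
  have hmain := measure_lt_norm_mean_sub_integral_le P hφ_meas hΔψ_pos hc hle hn hL
  rw [Real.exp_neg, Real.exp_log (by positivity), inv_div, mul_div_cancel₀ _ two_ne_zero] at hmain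
  simp only [hφ_kernel, ← hvhat, ← hμP] at hmain
  rw [ENNReal.ofReal_sub _ hδ0.le, ENNReal.ofReal_one, tsub_le_iff_right,
    ← measure_univ (μ := Measure.pi fun _ : Fin n => P)]
  refine (measure_mono fun ω _ => ?_).trans ((measure_union_le _ _).trans
    (add_le_add_right (ENNReal.le_ofReal_iff_toReal_le (measure_ne_top _ _) hδ0.le |>.2 hmain) _))
  exact le_or_gt ‖_‖ _
end

section
/- Let k(x,y) = ⟪φ(x), φ(y)⟫ for a bounded map φ : X → H into a real Hilbert space, with Δk := sup k − inf k and Δdiag k := sup_x k(x,x) − inf_x k(x,x), and assume Δdiag k + 2Δk > 0. Then for n ≥ 2, the function x ↦ n v̂(x) / (Δdiag k + 2Δk) on X^n is weakly (2, 2n·Δdiag k/(Δdiag k + 2Δk))-self-bounding and has the bounded differences property. -/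
open MeasureTheory
open scoped RealInnerProductSpace

/-- A double sum of a symmetric function vanishing on the diagonal, with one index singled out. -/
lemma sum_sum_eq_two_mul_sum_erase_add {ι X : Type*} [Fintype ι] [DecidableEq ι]
    (q : X → X → ℝ) (hsymm : ∀ a b, q a b = q b a) (hdiag : ∀ a, q a a = 0)
    (y : ι → X) (i : ι) :
    ∑ t, ∑ s, q (y t) (y s) = 2 * ∑ s ∈ Finset.univ.erase i, q (y i) (y s) +
      ∑ t ∈ Finset.univ.erase i, ∑ s ∈ Finset.univ.erase i, q (y t) (y s) := by
  have split (g : ι → ℝ) : ∑ t, g t = g i + ∑ t ∈ Finset.univ.erase i, g t :=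
    (Finset.add_sum_erase _ g (Finset.mem_univ i)).symm
  rw [split]
  simp_rw [split]
  rw [Finset.sum_add_distrib, hdiag, Finset.sum_congr rfl fun t _ => hsymm (y t) (y i)]
  ring

/-- The change of such a double sum when one coordinate is replaced. -/
lemma sum_sum_sub_sum_sum_update {ι X : Type*} [Fintype ι] [DecidableEq ι]
    (q : X → X → ℝ) (hsymm : ∀ a b, q a b = q b a) (hdiag : ∀ a, q a a = 0)
    (x : ι → X) (i : ι) (a : X) :
    ∑ t, ∑ s, q (x t) (x s) -
        ∑ t, ∑ s, q (Function.update x i a t) (Function.update x i a s) =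
      2 * ∑ s ∈ Finset.univ.erase i, (q (x i) (x s) - q a (x s)) := by
  rw [sum_sum_eq_two_mul_sum_erase_add q hsymm hdiag x i,
    sum_sum_eq_two_mul_sum_erase_add q hsymm hdiag (Function.update x i a) i]
  have upd : ∀ t ∈ Finset.univ.erase i, Function.update x i a t = x t := fun t ht =>
    Function.update_of_ne (Finset.ne_of_mem_erase ht) _ _
  have h1 : ∑ s ∈ Finset.univ.erase i, q (Function.update x i a i) (Function.update x i a s) =
      ∑ s ∈ Finset.univ.erase i, q a (x s) :=
    Finset.sum_congr rfl fun s hs => by rw [upd s hs, Function.update_self]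
  have h2 : ∑ t ∈ Finset.univ.erase i, ∑ s ∈ Finset.univ.erase i,
        q (Function.update x i a t) (Function.update x i a s) =
      ∑ t ∈ Finset.univ.erase i, ∑ s ∈ Finset.univ.erase i, q (x t) (x s) :=
    Finset.sum_congr rfl fun t ht => Finset.sum_congr rfl fun s hs => by rw [upd t ht, upd s hs]
  rw [h1, h2, Finset.sum_sub_distrib]
  ring

/-- For a kernel `k(x,y) = ⟪φ(x), φ(y)⟫` with bounded `φ`, the rescaled
empirical variance proxy `x ↦ n v̂(x)/(Δdiag k + 2Δk)` is weakly
`(2, 2n Δdiag k/(Δdiag k + 2Δk))`-self-bounding and has the bounded differences property. -/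
theorem general_kernel_proxy_self_bounding
    {X : Type*} [Nonempty X]
    {H : Type*} [NormedAddCommGroup H] [InnerProductSpace ℝ H]
    (φ : X → H) (C : ℝ) (hφ_bdd : ∀ x, ‖φ x‖ ≤ C)
    (k : X → X → ℝ) (hk : ∀ x y, k x y = ⟪φ x, φ y⟫)
    (kSup kInf : ℝ)
    (hkSup : IsLUB (Set.range fun p : X × X => k p.1 p.2) kSup)
    (hkInf : IsGLB (Set.range fun p : X × X => k p.1 p.2) kInf)
    (dSup dInf : ℝ)
    (hdSup : IsLUB (Set.range fun x => k x x) dSup)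
    (hdInf : IsGLB (Set.range fun x => k x x) dInf)
    (Δk Δdiag : ℝ) (hΔk : Δk = kSup - kInf) (hΔdiag : Δdiag = dSup - dInf)
    (hpos : 0 < Δdiag + 2 * Δk)
    (n : ℕ) (hn : 2 ≤ n)
    (vhat : (Fin n → X) → ℝ)
    (hvhat : ∀ x, vhat x = (1 / ((n : ℝ) - 1)) *
      ∑ t : Fin n, (k (x t) (x t) - (1 / (n : ℝ)) * ∑ s : Fin n, k (x t) (x s)))
    (f : (Fin n → X) → ℝ)
    (hf : ∀ x, f x = (n : ℝ) * vhat x / (Δdiag + 2 * Δk)) :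
    (∀ x : Fin n → X, ∑ t₀ : Fin n,
        (f x - ⨅ x' : X, f (Function.update x t₀ x')) ^ 2 ≤
          2 * f x + 2 * (n : ℝ) * Δdiag / (Δdiag + 2 * Δk)) ∧
    (∀ x : Fin n → X, ∀ t₀ : Fin n,
        f x - (⨅ x' : X, f (Function.update x t₀ x')) ≤ 1) := by
  set D := Δdiag + 2 * Δk with hD
  have hn1 : (0 : ℝ) < (n : ℝ) - 1 := by
    have : (2 : ℝ) ≤ n := by exact_mod_cast hn
    linarith
  have hn0 : (0 : ℝ) < n := by linarith
  have hk_symm : ∀ a b, k a b = k b a := fun a b => by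
    rw [hk, hk, real_inner_comm]
  -- squared feature distance
  obtain ⟨q, hq⟩ : ∃ q : X → X → ℝ, ∀ a b, q a b = k a a - 2 * k a b + k b b :=
    ⟨_, fun _ _ => rfl⟩
  have q_symm : ∀ a b, q a b = q b a := fun a b => by
    rw [hq, hq, hk_symm a b]; ring
  have q_diag : ∀ a, q a a = 0 := fun a => by rw [hq]; ring
  have q_nonneg : ∀ a b, 0 ≤ q a b := fun a b => by
    have h := norm_sub_sq_real (φ a) (φ b)
    rw [hq, hk, hk, hk, real_inner_self_eq_norm_sq, real_inner_self_eq_norm_sq, ← h]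
    positivity
  have q_sub_le : ∀ a a' b, q a b - q a' b ≤ D := fun a a' b => by
    have h1 := hdSup.1 ⟨a, rfl⟩
    have h2 := hdInf.1 ⟨a', rfl⟩
    have h3 := hkSup.1 ⟨(a', b), rfl⟩
    have h4 := hkInf.1 ⟨(a, b), rfl⟩
    dsimp only at h1 h2 h3 h4
    rw [hq, hq, hD, hΔk, hΔdiag]
    linarith
  have Δdiag_nonneg : 0 ≤ Δdiag := by
    obtain ⟨a⟩ := ‹Nonempty X›
    have h1 := hdSup.1 ⟨a, rfl⟩
    have h2 := hdInf.1 ⟨a, rfl⟩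
    dsimp only at h1 h2
    linarith
  have f_eq : ∀ x, f x = (∑ t, ∑ s, q (x t) (x s)) / (2 * ((n : ℝ) - 1) * D) := fun x => by
    have h : ∑ t, ∑ s, q (x t) (x s) =
        2 * (n * ∑ t, k (x t) (x t)) - 2 * ∑ t, ∑ s, k (x t) (x s) := by
      simp only [hq, Finset.sum_add_distrib, Finset.sum_sub_distrib, Finset.sum_const,
        Finset.card_univ, Fintype.card_fin, nsmul_eq_mul, ← Finset.mul_sum]
      ring
    rw [hf, hvhat, h, Finset.sum_sub_distrib, ← Finset.mul_sum]
    field_simp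
  have f_nonneg : ∀ x, 0 ≤ f x := fun x => by
    rw [f_eq]
    exact div_nonneg (Finset.sum_nonneg fun t _ => Finset.sum_nonneg fun s _ => q_nonneg _ _)
      (by positivity)
  have f_sub : ∀ x i a, f x - f (Function.update x i a) =
      (∑ s ∈ Finset.univ.erase i, (q (x i) (x s) - q a (x s))) / (((n : ℝ) - 1) * D) :=
    fun x i a => by
      rw [f_eq, f_eq, ← sub_div, sum_sum_sub_sum_sum_update q q_symm q_diag]
      field_simp
  have sub_iInf_le : ∀ x i c, (∀ a, f x - f (Function.update x i a) ≤ c) →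
      f x - (⨅ a, f (Function.update x i a)) ≤ c := fun x i c h => by
    have := le_ciInf (f := fun a => f (Function.update x i a)) (c := f x - c)
      fun a => by linarith [h a]
    linarith
  have sub_iInf_nonneg : ∀ x i, 0 ≤ f x - (⨅ a, f (Function.update x i a)) := fun x i => by
    have h := ciInf_le (f := fun a => f (Function.update x i a))
      ⟨0, Set.forall_mem_range.2 fun a => f_nonneg _⟩ (x i)
    rw [Function.update_eq_self] at h
    linarith
  have sub_iInf_le_one : ∀ x i, f x - (⨅ a, f (Function.update x i a)) ≤ 1 := fun x i => by
    refine sub_iInf_le x i 1 fun a => ?_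
    rw [f_sub, div_le_one (by positivity)]
    refine (Finset.sum_le_card_nsmul _ _ D fun s _ => q_sub_le _ _ _).trans_eq ?_
    rw [Finset.card_erase_of_mem (Finset.mem_univ i), Finset.card_univ, Fintype.card_fin,
      nsmul_eq_mul, Nat.cast_sub (by lia), Nat.cast_one]
  refine ⟨fun x => ?_, sub_iInf_le_one⟩
  calc ∑ i, (f x - ⨅ a, f (Function.update x i a)) ^ 2
      ≤ ∑ i, (∑ s, q (x i) (x s)) / (((n : ℝ) - 1) * D) := by
        refine Finset.sum_le_sum fun i _ => ?_
        refine (pow_le_of_le_one (sub_iInf_nonneg x i) (sub_iInf_le_one x i) two_ne_zero).trans ?_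
        refine sub_iInf_le x i _ fun a => ?_
        rw [f_sub]
        refine div_le_div_of_nonneg_right ?_ (by positivity)
        refine (Finset.sum_le_sum fun s _ => sub_le_self _ (q_nonneg a (x s))).trans ?_
        exact Finset.sum_le_sum_of_subset_of_nonneg (Finset.erase_subset _ _)
          fun s _ _ => q_nonneg _ _
    _ = 2 * f x := by
        rw [← Finset.sum_div, f_eq]
        field_simp
    _ ≤ 2 * f x + 2 * (n : ℝ) * Δdiag / D := le_add_of_nonneg_right (by positivity)
end
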